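/- arXiv:2112.13695 — 4 statements merged into one kernel-verified Lean document; each statement's English description precedes it below -/
import Mathlib

section
/- Let C = ∫₀^∞ exp(−2 ∫₀ᵗ (1 − e^{−u})/u du) dt be Rényi's constant. Suppose that for each λ > 0 there is a function M_λ : ℝ → ℝ, measurable and nondecreasing with 0 ≤ M_λ(x) ≤ x, satisfying the exponential parking equation with rate λ, and suppose the limits C_λ = lim_{x→∞} M_λ(x)/x and B_λ = lim_{x→∞} (M_λ(x) − C_λ x) exist for each λ. Then lim_{λ→0⁺} C_λ = C and lim_{λ→0⁺} B_λ = −(1 − C). -/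
open MeasureTheory Filter

/-- `M` satisfies the exponential parking equation with rate `lam`:
`M = 0` on `[0,1]` and for every `x > 0`,
`M (x+1) = ∫₀ˣ (lam * e^{-lam t} / (1 - e^{-lam x})) * (M t + M (x - t)) dt + 1`. -/
def SatisfiesExpParkingEq (lam : ℝ) (M : ℝ → ℝ) : Prop :=
  (∀ x : ℝ, 0 ≤ x → x ≤ 1 → M x = 0) ∧
  ∀ x : ℝ, 0 < x →
    M (x + 1) = (∫ t in (0:ℝ)..x,
      (lam * Real.exp (-lam * t) / (1 - Real.exp (-lam * x))) * (M t + M (x - t))) + 1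

/-- A measurable function with at most linear growth is integrable on every bounded interval. -/
theorem intervalIntegrable_of_linear_bound {f : ℝ → ℝ} (hf : Measurable f) {A : ℝ}
    (hA : ∀ x, |f x| ≤ A * (|x| + 1)) (a b : ℝ) : IntervalIntegrable f volume a b := by
  have h : IntervalIntegrable (fun x : ℝ => A * (|x| + 1)) volume a b :=
    Continuous.intervalIntegrable (by fun_prop) _ _
  exact h.mono_fun' hf.aestronglyMeasurable (Eventually.of_forall fun x => by
    simpa using hA x)

/-- Successive approximations of the function `N = M + 1`, where `M` is the expected number of
cars in the uniform parking problem. -/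
noncomputable def renyiIter : ℕ → ℝ → ℝ
  | 0 => fun _ => 1
  | n + 1 => fun x => if x ≤ 1 then 1 else 2 / (x - 1) * ∫ t in (0:ℝ)..(x - 1), renyiIter n t

theorem renyiIter_succ (n : ℕ) (x : ℝ) : renyiIter (n + 1) x =
    if x ≤ 1 then 1 else 2 / (x - 1) * ∫ t in (0:ℝ)..(x - 1), renyiIter n t := rfl

theorem abs_integral_le_of_linear_bound {f : ℝ → ℝ} (hf : ∀ x, |f x| ≤ |x| + 1) {y : ℝ}
    (hy : 0 ≤ y) : |∫ t in (0:ℝ)..y, f t| ≤ y ^ 2 / 2 + y := by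
  have h1 : |∫ t in (0:ℝ)..y, f t| ≤ ∫ t in (0:ℝ)..y, (t + 1) := by
    rw [← Real.norm_eq_abs]
    apply intervalIntegral.norm_integral_le_of_norm_le hy
    · refine Eventually.of_forall fun t ht => ?_
      have := hf t
      rwa [abs_of_pos ht.1] at this
    · exact Continuous.intervalIntegrable (by fun_prop) _ _
  refine h1.trans (le_of_eq ?_)
  rw [intervalIntegral.integral_add (by simp) (by simp)]
  simp

theorem renyiIter_measurable_and_bound (n : ℕ) :
    Measurable (renyiIter n) ∧ ∀ x, |renyiIter n x| ≤ |x| + 1 := by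
  induction n with
  | zero => exact ⟨measurable_const, fun x => by simp [renyiIter]⟩
  | succ n ih =>
    obtain ⟨hm, hb⟩ := ih
    constructor
    · have hc : Continuous fun x => ∫ t in (0:ℝ)..x, renyiIter n t :=
        intervalIntegral.continuous_primitive
          (intervalIntegrable_of_linear_bound hm (A := 1) (by simpa using hb)) 0
      refine Measurable.ite measurableSet_Iic measurable_const ?_
      have : Measurable fun x : ℝ => ∫ t in (0:ℝ)..(x - 1), renyiIter n t :=
        hc.measurable.comp (measurable_id.sub_const 1)
      fun_prop
    · intro x
      rw [renyiIter_succ]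
      split_ifs with hx
      · simp
      · push Not at hx
        have h := abs_integral_le_of_linear_bound hb (y := x - 1) (by linarith)
        have hx' : 0 < x - 1 := by linarith
        rw [abs_mul, abs_of_pos (by positivity : 0 < 2 / (x - 1)), abs_of_pos (by linarith : 0 < x)]
        calc _ ≤ 2 / (x - 1) * ((x - 1) ^ 2 / 2 + (x - 1)) := by gcongr
          _ = x + 1 := by field_simp; ring

theorem renyiIter_succ_eq (n : ℕ) : ∀ x : ℝ, x ≤ n + 1 → renyiIter (n + 1) x = renyiIter n x := by
  induction n with
  | zero => intro x hx; simp only [Nat.cast_zero, zero_add] at hx; simp [renyiIter, hx]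
  | succ n ih =>
    intro x hx
    push_cast at hx
    rw [renyiIter_succ, renyiIter_succ]
    split_ifs with h
    · rfl
    · push Not at h
      congr 1
      apply intervalIntegral.integral_congr
      intro t ht
      rw [Set.uIcc_of_le (by linarith)] at ht
      exact ih t (by linarith [ht.2])

theorem renyiIter_eq_of_le {m n : ℕ} (h : n ≤ m) {x : ℝ} (hx : x ≤ n + 1) :
    renyiIter m x = renyiIter n x := by
  induction m, h using Nat.le_induction with
  | base => rfl
  | succ m hm ih =>
    have : (n : ℝ) ≤ m := by exact_mod_cast hm
    rw [renyiIter_succ_eq m x (by linarith), ih]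

/-- A solution of Rényi's equation, written for `N = M + 1`. -/
noncomputable def renyiFun (x : ℝ) : ℝ := renyiIter ⌈x⌉₊ x

theorem renyiFun_eq_iter {n : ℕ} {x : ℝ} (hx : x ≤ n + 1) : renyiFun x = renyiIter n x := by
  have h1 : x ≤ ⌈x⌉₊ := Nat.le_ceil x
  rw [renyiFun]
  rcases le_total n ⌈x⌉₊ with h | h
  · exact renyiIter_eq_of_le h hx
  · exact (renyiIter_eq_of_le h (by linarith)).symm

theorem measurable_renyiFun : Measurable renyiFun := by
  refine measurable_of_tendsto_metrizable (fun n => (renyiIter_measurable_and_bound n).1) ?_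
  rw [tendsto_pi_nhds]
  intro x
  refine tendsto_const_nhds.congr' ?_
  filter_upwards [eventually_ge_atTop ⌈x⌉₊] with n hn
  exact (renyiIter_eq_of_le hn (by linarith [Nat.le_ceil x])).symm

theorem abs_renyiFun_le (x : ℝ) : |renyiFun x| ≤ |x| + 1 :=
  (renyiIter_measurable_and_bound _).2 x

theorem renyiFun_of_le_one {x : ℝ} (hx : x ≤ 1) : renyiFun x = 1 := by
  rw [renyiFun_eq_iter (n := 0) (by simpa using hx)]
  rfl

theorem mul_renyiFun_add_one {x : ℝ} (hx : 0 < x) :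
    x * renyiFun (x + 1) = 2 * ∫ t in (0:ℝ)..x, renyiFun t := by
  have h1 : x ≤ ⌈x⌉₊ := Nat.le_ceil x
  rw [renyiFun_eq_iter (n := ⌈x⌉₊ + 1) (by push_cast; linarith), renyiIter_succ, if_neg (by linarith)]
  have h2 : ∫ t in (0:ℝ)..x, renyiFun t = ∫ t in (0:ℝ)..x, renyiIter ⌈x⌉₊ t := by
    apply intervalIntegral.integral_congr
    intro t ht
    rw [Set.uIcc_of_le hx.le] at ht
    exact renyiFun_eq_iter (by linarith [ht.2])
  rw [h2, add_sub_cancel_right]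
  field_simp

theorem renyiFun_eq_two {x : ℝ} (h1 : 1 < x) (h2 : x ≤ 2) : renyiFun x = 2 := by
  have h := mul_renyiFun_add_one (x := x - 1) (by linarith)
  have h3 : ∫ t in (0:ℝ)..(x - 1), renyiFun t = ∫ _ in (0:ℝ)..(x - 1), (1:ℝ) := by
    apply intervalIntegral.integral_congr
    intro t ht
    rw [Set.uIcc_of_le (by linarith)] at ht
    exact renyiFun_of_le_one (by linarith [ht.2])
  rw [h3, sub_add_cancel] at h
  simp only [intervalIntegral.integral_const, smul_eq_mul, mul_one, sub_zero] at h
  have h4 : x - 1 ≠ 0 := by linarith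
  apply mul_left_cancel₀ h4
  linarith

/-- The weight `exp (-2 ∫₀ᵗ (1 - e^{-u})/u du)` whose integral is Rényi's constant. -/
noncomputable def renyiWeight (t : ℝ) : ℝ :=
  Real.exp (-2 * ∫ u in (0:ℝ)..t, (1 - Real.exp (-u)) / u)

theorem one_sub_exp_neg_div_le_one {u : ℝ} (hu : 0 < u) : (1 - Real.exp (-u)) / u ≤ 1 := by
  rw [div_le_one hu]
  linarith [Real.add_one_le_exp (-u)]

theorem inv_one_add_le_one_sub_exp_neg_div {u : ℝ} (hu : 0 < u) :
    (1 + u)⁻¹ ≤ (1 - Real.exp (-u)) / u := by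
  have h1 := Real.add_one_le_exp u
  have h2 : Real.exp (-u) ≤ (1 + u)⁻¹ := by
    rw [Real.exp_neg]
    exact inv_anti₀ (by linarith) (by linarith)
  rw [le_div_iff₀ hu]
  have h3 : (1 + u)⁻¹ * u = 1 - (1 + u)⁻¹ := by field_simp; ring
  linarith

theorem measurable_one_sub_exp_neg_div : Measurable fun u : ℝ => (1 - Real.exp (-u)) / u := by
  fun_prop

theorem intervalIntegrable_one_sub_exp_neg_div {t : ℝ} (ht : 0 ≤ t) :
    IntervalIntegrable (fun u : ℝ => (1 - Real.exp (-u)) / u) volume 0 t := by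
  have h : IntervalIntegrable (fun _ : ℝ => (1:ℝ)) volume 0 t := by simp
  refine h.mono_fun' measurable_one_sub_exp_neg_div.aestronglyMeasurable ?_
  rw [Set.uIoc_of_le ht]
  refine (ae_restrict_iff' measurableSet_Ioc).2 (Eventually.of_forall fun u hu => ?_)
  have h2 : 0 ≤ (1 - Real.exp (-u)) / u :=
    le_trans (by have := hu.1; positivity) (inv_one_add_le_one_sub_exp_neg_div hu.1)
  simp only [Real.norm_of_nonneg h2]
  exact one_sub_exp_neg_div_le_one hu.1

theorem hasDerivAt_renyiWeight {t : ℝ} (ht : 0 < t) :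
    HasDerivAt renyiWeight (-2 * ((1 - Real.exp (-t)) / t) * renyiWeight t) t := by
  have h : HasDerivAt (fun t => ∫ u in (0:ℝ)..t, (1 - Real.exp (-u)) / u)
      ((1 - Real.exp (-t)) / t) t := by
    refine intervalIntegral.integral_hasDerivAt_right (intervalIntegrable_one_sub_exp_neg_div ht.le)
      (measurable_one_sub_exp_neg_div.stronglyMeasurable.stronglyMeasurableAtFilter) ?_
    exact ContinuousAt.div (by fun_prop) continuousAt_id ht.ne'
  have h2 := (h.const_mul (-2)).exp
  rw [mul_comm]
  exact h2

theorem renyiWeight_pos (t : ℝ) : 0 < renyiWeight t := Real.exp_pos _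

theorem exp_neg_two_mul_le_renyiWeight {t : ℝ} (ht : 0 ≤ t) :
    Real.exp (-2 * t) ≤ renyiWeight t := by
  have h : ∫ u in (0:ℝ)..t, (1 - Real.exp (-u)) / u ≤ ∫ _ in (0:ℝ)..t, (1:ℝ) :=
    intervalIntegral.integral_mono_on_of_le_Ioo ht (intervalIntegrable_one_sub_exp_neg_div ht)
      (by simp) fun u hu => one_sub_exp_neg_div_le_one hu.1
  simp only [intervalIntegral.integral_const, smul_eq_mul, mul_one, sub_zero] at h
  exact Real.exp_le_exp.2 (by linarith)

theorem renyiWeight_le {t : ℝ} (ht : 0 ≤ t) : renyiWeight t ≤ ((1 + t) ^ 2)⁻¹ := by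
  have hint : ∫ u in (0:ℝ)..t, (1 + u)⁻¹ = Real.log (1 + t) := by
    have := intervalIntegral.integral_comp_add_left (fun x : ℝ => x⁻¹) (1:ℝ) (a := 0) (b := t)
    rw [this, integral_inv_of_pos (by norm_num) (by linarith)]
    simp
  have h : ∫ u in (0:ℝ)..t, (1 + u)⁻¹ ≤ ∫ u in (0:ℝ)..t, (1 - Real.exp (-u)) / u := by
    refine intervalIntegral.integral_mono_on_of_le_Ioo ht ?_
      (intervalIntegrable_one_sub_exp_neg_div ht) fun u hu =>
        inv_one_add_le_one_sub_exp_neg_div hu.1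
    refine ContinuousOn.intervalIntegrable (ContinuousOn.inv₀ (by fun_prop) fun u hu => ?_)
    rw [Set.uIcc_of_le ht] at hu
    linarith [hu.1]
  rw [hint] at h
  calc renyiWeight t ≤ Real.exp (-(2 * Real.log (1 + t))) := Real.exp_le_exp.2 (by linarith)
    _ = ((1 + t) ^ 2)⁻¹ := by
      rw [Real.exp_neg, two_mul, Real.exp_add, Real.exp_log (by linarith), sq]

theorem renyiWeight_le_one {t : ℝ} (ht : 0 ≤ t) : renyiWeight t ≤ 1 :=
  (renyiWeight_le ht).trans (inv_le_one_of_one_le₀ (by nlinarith))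

theorem aestronglyMeasurable_renyiWeight :
    AEStronglyMeasurable renyiWeight (volume.restrict (Set.Ioi 0)) :=
  ContinuousOn.aestronglyMeasurable
    (fun _ ht => (hasDerivAt_renyiWeight ht).continuousAt.continuousWithinAt) measurableSet_Ioi

theorem integrableOn_renyiWeight : IntegrableOn renyiWeight (Set.Ioi 0) := by
  refine Integrable.mono' (g := fun t : ℝ => (1 + t ^ 2)⁻¹)
    integrable_inv_one_add_sq.integrableOn aestronglyMeasurable_renyiWeight ?_
  refine (ae_restrict_iff' measurableSet_Ioi).2 (Eventually.of_forall fun t ht => ?_)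
  have ht' : 0 < t := ht
  rw [Real.norm_of_nonneg (renyiWeight_pos t).le]
  exact (renyiWeight_le ht'.le).trans (inv_anti₀ (by positivity) (by nlinarith))

theorem integrableOn_exp_mul_renyiWeight {u : ℝ} (hu : 0 ≤ u) :
    IntegrableOn (fun t => Real.exp (-(u * t)) * renyiWeight t) (Set.Ioi 0) := by
  refine Integrable.mono' integrableOn_renyiWeight
    ((Continuous.aestronglyMeasurable (by fun_prop)).mul aestronglyMeasurable_renyiWeight) ?_
  refine (ae_restrict_iff' measurableSet_Ioi).2 (Eventually.of_forall fun t ht => ?_)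
  have ht' : 0 < t := ht
  have hp := renyiWeight_pos t
  rw [Real.norm_of_nonneg (by positivity)]
  refine mul_le_of_le_one_left hp.le (Real.exp_le_one_iff.2 ?_)
  nlinarith

theorem integrableOn_mul_exp_neg {a : ℝ} (ha : 0 < a) :
    IntegrableOn (fun t : ℝ => t * Real.exp (-(a * t))) (Set.Ioi 0) := by
  have h := integrableOn_rpow_mul_exp_neg_mul_rpow (s := 1) (p := 1) (b := a)
    (by norm_num) one_pos ha
  simpa using h

theorem integral_mul_exp_neg {a : ℝ} (ha : 0 < a) :
    ∫ t in Set.Ioi (0:ℝ), t * Real.exp (-(a * t)) = (a ^ 2)⁻¹ := by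
  have h := Real.integral_rpow_mul_exp_neg_mul_Ioi (a := 2) (r := a) (by norm_num) ha
  have h2 : (2:ℝ) - 1 = 1 := by norm_num
  simpa [h2] using h

theorem integrableOn_mul_exp_mul_renyiWeight {u : ℝ} (hu : 0 < u) :
    IntegrableOn (fun t => t * Real.exp (-(u * t)) * renyiWeight t) (Set.Ioi 0) := by
  refine Integrable.mono' (integrableOn_mul_exp_neg hu)
    ((Continuous.aestronglyMeasurable (by fun_prop)).mul aestronglyMeasurable_renyiWeight) ?_
  refine (ae_restrict_iff' measurableSet_Ioi).2 (Eventually.of_forall fun t ht => ?_)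
  have ht' : 0 < t := ht
  have hp := renyiWeight_pos t
  rw [Real.norm_of_nonneg (by positivity)]
  exact mul_le_of_le_one_right (by positivity) (renyiWeight_le_one ht'.le)

/-- The Laplace transform of `renyiWeight`. -/
noncomputable def renyiLaplace (u : ℝ) : ℝ :=
  ∫ t in Set.Ioi (0:ℝ), Real.exp (-(u * t)) * renyiWeight t

/-- The negated derivative of `renyiLaplace`, which solves the equation adjoint to
the delay equation of Rényi. -/
noncomputable def renyiAdjoint (u : ℝ) : ℝ :=
  ∫ t in Set.Ioi (0:ℝ), t * Real.exp (-(u * t)) * renyiWeight t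

theorem hasDerivAt_renyiLaplace {u : ℝ} (hu : 0 < u) :
    HasDerivAt renyiLaplace (-renyiAdjoint u) u := by
  have h := hasDerivAt_integral_of_dominated_loc_of_deriv_le
    (μ := volume.restrict (Set.Ioi (0:ℝ)))
    (F := fun (x t : ℝ) => Real.exp (-(x * t)) * renyiWeight t)
    (F' := fun (x t : ℝ) => -(t * Real.exp (-(x * t)) * renyiWeight t)) (x₀ := u)
    (s := Set.Ioi (u / 2)) (bound := fun t : ℝ => t * Real.exp (-(u / 2 * t)))
    (Ioi_mem_nhds (by linarith))
    (Eventually.of_forall fun x =>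
      (Continuous.aestronglyMeasurable (by fun_prop)).mul aestronglyMeasurable_renyiWeight)
    (integrableOn_exp_mul_renyiWeight hu.le)
    (integrableOn_mul_exp_mul_renyiWeight hu).neg.aestronglyMeasurable ?_
    (integrableOn_mul_exp_neg (by linarith)) ?_
  · rw [renyiAdjoint, ← integral_neg]
    exact h.2
  · refine (ae_restrict_iff' measurableSet_Ioi).2 (Eventually.of_forall fun t ht x hx => ?_)
    have ht' : 0 < t := ht
    have hx' : u / 2 < x := hx
    have hp := renyiWeight_pos t
    rw [norm_neg, Real.norm_of_nonneg (by positivity)]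
    refine (mul_le_of_le_one_right (by positivity) (renyiWeight_le_one ht'.le)).trans ?_
    gcongr
  · refine Eventually.of_forall fun t x _ => ?_
    have h1 : HasDerivAt (fun x : ℝ => -(x * t)) (-(1 * t)) x := ((hasDerivAt_id x).mul_const t).neg
    refine (h1.exp.mul_const (renyiWeight t)).congr_deriv ?_
    ring

theorem mul_renyiAdjoint {u : ℝ} (hu : 0 ≤ u) :
    u * renyiAdjoint u = 2 * renyiLaplace (u + 1) - renyiLaplace u := by
  have hbound : ∀ t : ℝ, 0 ≤ t → |Real.exp (-(u * t)) * t * renyiWeight t| ≤ t / (1 + t) ^ 2 := by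
    intro t ht
    have hp := renyiWeight_pos t
    rw [abs_of_nonneg (by positivity), mul_assoc]
    refine (mul_le_of_le_one_left (by positivity) (Real.exp_le_one_iff.2 (by nlinarith))).trans ?_
    rw [div_eq_mul_inv]
    exact mul_le_mul_of_nonneg_left (renyiWeight_le ht) ht
  have hd : ∀ t ∈ Set.Ioi (0:ℝ),
      HasDerivAt (fun t => Real.exp (-(u * t)) * t * renyiWeight t)
        (-(u * (t * Real.exp (-(u * t)) * renyiWeight t))
          + (2 * (Real.exp (-((u + 1) * t)) * renyiWeight t)
            - Real.exp (-(u * t)) * renyiWeight t)) t := by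
    intro t ht
    have ht' : (0:ℝ) < t := ht
    have h1 : HasDerivAt (fun t : ℝ => -(u * t)) (-(u * 1)) t := ((hasDerivAt_id t).const_mul u).neg
    refine ((h1.exp.mul (hasDerivAt_id t)).mul (hasDerivAt_renyiWeight ht')).congr_deriv ?_
    have h2 : Real.exp (-((u + 1) * t)) = Real.exp (-(u * t)) * Real.exp (-t) := by
      rw [← Real.exp_add]; ring_nf
    rw [h2]
    simp only [id, Pi.mul_apply]
    field_simp
    ring
  have hi1 : IntegrableOn (fun t => u * (t * Real.exp (-(u * t)) * renyiWeight t)) (Set.Ioi 0) := by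
    rcases hu.eq_or_lt with rfl | hu
    · simp
    · exact (integrableOn_mul_exp_mul_renyiWeight hu).const_mul u
  have hi2 := (integrableOn_exp_mul_renyiWeight (u := u + 1) (by linarith)).const_mul 2
  have hi3 := integrableOn_exp_mul_renyiWeight hu
  have hlim : Tendsto (fun t => Real.exp (-(u * t)) * t * renyiWeight t) atTop (nhds 0) := by
    have h0 : Tendsto (fun t : ℝ => t⁻¹) atTop (nhds 0) := tendsto_inv_atTop_zero
    refine squeeze_zero_norm' ?_ h0
    filter_upwards [eventually_gt_atTop 0] with t ht
    refine (hbound t ht.le).trans ?_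
    rw [div_le_iff₀ (by positivity), ← div_eq_inv_mul, le_div_iff₀ ht]
    nlinarith
  have hcont : ContinuousWithinAt (fun t => Real.exp (-(u * t)) * t * renyiWeight t)
      (Set.Ici 0) 0 := by
    rw [ContinuousWithinAt]
    simp only [mul_zero, zero_mul]
    have h0 : Tendsto (fun t : ℝ => t) (nhdsWithin 0 (Set.Ici 0)) (nhds 0) :=
      tendsto_nhdsWithin_of_tendsto_nhds tendsto_id
    refine squeeze_zero_norm' ?_ h0
    filter_upwards [self_mem_nhdsWithin] with t ht
    have ht' : (0:ℝ) ≤ t := ht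
    refine (hbound t ht').trans (div_le_self ht' (by nlinarith))
  have h := integral_Ioi_of_hasDerivAt_of_tendsto hcont hd (hi1.neg.add (hi2.sub hi3)) hlim
  rw [integral_add (f := fun t => -(u * (t * Real.exp (-(u * t)) * renyiWeight t)))
      (g := fun t => 2 * (Real.exp (-((u + 1) * t)) * renyiWeight t)
        - Real.exp (-(u * t)) * renyiWeight t) hi1.neg (hi2.sub hi3),
    integral_neg, integral_sub hi2 hi3, integral_const_mul, integral_const_mul] at h
  simp only [mul_zero, zero_mul, sub_zero] at h
  rw [renyiAdjoint, renyiLaplace, renyiLaplace]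
  linarith

theorem renyiLaplace_zero : renyiLaplace 0 = 2 * renyiLaplace 1 := by
  have h := mul_renyiAdjoint le_rfl
  rw [zero_mul, zero_add] at h
  linarith

theorem hasDerivAt_renyiAdjoint {u : ℝ} (hu : 0 < u) :
    HasDerivAt renyiAdjoint (-2 * renyiAdjoint (u + 1) / u) u := by
  have h1 : HasDerivAt (fun x => (2 * renyiLaplace (x + 1) - renyiLaplace x) / x)
      (-2 * renyiAdjoint (u + 1) / u) u := by
    have h2 : HasDerivAt (fun x => renyiLaplace (x + 1)) (-renyiAdjoint (u + 1)) u :=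
      (hasDerivAt_renyiLaplace (by linarith : 0 < u + 1)).comp_add_const u 1
    refine (((h2.const_mul 2).sub (hasDerivAt_renyiLaplace hu)).div (hasDerivAt_id u)
      hu.ne').congr_deriv ?_
    have h3 := mul_renyiAdjoint hu.le
    simp only [id, Pi.sub_apply]
    rw [← h3]
    field_simp
    ring
  refine h1.congr_of_eventuallyEq ?_
  filter_upwards [Ioi_mem_nhds hu] with x hx
  have hx' : 0 < x := hx
  rw [← mul_renyiAdjoint hx'.le]
  field_simp

theorem renyiAdjoint_le {u : ℝ} (hu : 0 < u) : renyiAdjoint u ≤ (u ^ 2)⁻¹ := by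
  rw [← integral_mul_exp_neg hu]
  refine setIntegral_mono_on (integrableOn_mul_exp_mul_renyiWeight hu)
    (integrableOn_mul_exp_neg hu) measurableSet_Ioi fun t ht => ?_
  have ht' : (0:ℝ) < t := ht
  exact mul_le_of_le_one_right (by positivity) (renyiWeight_le_one ht'.le)

theorem le_renyiAdjoint {u : ℝ} (hu : 0 < u) : ((u + 2) ^ 2)⁻¹ ≤ renyiAdjoint u := by
  rw [← integral_mul_exp_neg (by linarith : 0 < u + 2)]
  refine setIntegral_mono_on (integrableOn_mul_exp_neg (by linarith))
    (integrableOn_mul_exp_mul_renyiWeight hu) measurableSet_Ioi fun t ht => ?_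
  have ht' : (0:ℝ) < t := ht
  have h : Real.exp (-((u + 2) * t)) = Real.exp (-(u * t)) * Real.exp (-2 * t) := by
    rw [← Real.exp_add]; ring_nf
  rw [h, mul_assoc]
  gcongr
  exact exp_neg_two_mul_le_renyiWeight ht'.le

theorem renyiAdjoint_pos {u : ℝ} (hu : 0 < u) : 0 < renyiAdjoint u :=
  lt_of_lt_of_le (by positivity) (le_renyiAdjoint hu)

theorem renyiAdjoint_le_renyiAdjoint {u v : ℝ} (hu : 0 < u) (huv : u ≤ v) :
    renyiAdjoint v ≤ renyiAdjoint u := by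
  refine setIntegral_mono_on (integrableOn_mul_exp_mul_renyiWeight (hu.trans_le huv))
    (integrableOn_mul_exp_mul_renyiWeight hu) measurableSet_Ioi fun t ht => ?_
  have ht' : (0:ℝ) < t := ht
  have hp := renyiWeight_pos t
  gcongr

theorem continuous_primitive_of_linear_bound {f : ℝ → ℝ} (hf : Measurable f) {A : ℝ}
    (hA : ∀ x, |f x| ≤ A * (|x| + 1)) : Continuous fun x => ∫ t in (0:ℝ)..x, f t :=
  intervalIntegral.continuous_primitive (intervalIntegrable_of_linear_bound hf hA) 0

theorem hasDerivAt_primitive_of_linear_bound {f : ℝ → ℝ} (hf : Measurable f) {A : ℝ}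
    (hA : ∀ x, |f x| ≤ A * (|x| + 1)) {x : ℝ} (hx : ContinuousAt f x) :
    HasDerivAt (fun y => ∫ t in (0:ℝ)..y, f t) (f x) x :=
  intervalIntegral.integral_hasDerivAt_right (intervalIntegrable_of_linear_bound hf hA 0 x)
    hf.stronglyMeasurable.stronglyMeasurableAtFilter hx

/-- If `|f'| ≤ -g'` on `(a, ∞)`, then increments of `f` are bounded by decrements of `g`. -/
theorem abs_sub_le_sub_of_abs_deriv_le {f g f' g' : ℝ → ℝ} {a : ℝ}
    (hfc : ContinuousOn f (Set.Ici a)) (hgc : ContinuousOn g (Set.Ici a))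
    (hf : ∀ x, a < x → HasDerivAt f (f' x) x) (hg : ∀ x, a < x → HasDerivAt g (g' x) x)
    (hfg : ∀ x, a < x → |f' x| ≤ -g' x) {x y : ℝ} (hx : a ≤ x) (hxy : x ≤ y) :
    |f y - f x| ≤ g x - g y := by
  have hadd : AntitoneOn (f + g) (Set.Ici a) := by
    refine antitoneOn_of_deriv_nonpos (convex_Ici a) (hfc.add hgc) ?_ ?_
    · intro z hz
      rw [interior_Ici] at hz
      exact ((hf z hz).add (hg z hz)).differentiableAt.differentiableWithinAt
    · intro z hz
      rw [interior_Ici] at hz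
      rw [((hf z hz).add (hg z hz)).deriv]
      linarith [(abs_le.1 (hfg z hz)).2]
  have hsub : AntitoneOn (g - f) (Set.Ici a) := by
    refine antitoneOn_of_deriv_nonpos (convex_Ici a) (hgc.sub hfc) ?_ ?_
    · intro z hz
      rw [interior_Ici] at hz
      exact ((hg z hz).sub (hf z hz)).differentiableAt.differentiableWithinAt
    · intro z hz
      rw [interior_Ici] at hz
      rw [((hg z hz).sub (hf z hz)).deriv]
      linarith [(abs_le.1 (hfg z hz)).1]
  have h1 := hadd hx (hx.trans hxy) hxy
  have h2 := hsub hx (hx.trans hxy) hxy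
  simp only [Pi.add_apply, Pi.sub_apply] at h1 h2
  rw [abs_le]
  constructor <;> linarith

theorem continuousOn_renyiAdjoint : ContinuousOn renyiAdjoint (Set.Ioi 0) :=
  fun _ hu => (hasDerivAt_renyiAdjoint hu).continuousAt.continuousWithinAt

/-- A solution of `x F(x + 1) = 2 ∫₀ˣ F` is continuous on `(1, ∞)`. -/
theorem continuousAt_of_renyiEq {F : ℝ → ℝ} (hF : Measurable F) {A : ℝ}
    (hA : ∀ x, |F x| ≤ A * (|x| + 1))
    (hEq : ∀ x, 0 < x → x * F (x + 1) = 2 * ∫ t in (0:ℝ)..x, F t) {x : ℝ} (hx : 1 < x) :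
    ContinuousAt F x := by
  have hc := continuous_primitive_of_linear_bound hF hA
  have h1 : ContinuousAt (fun y => 2 * (∫ t in (0:ℝ)..(y - 1), F t) / (y - 1)) x := by
    refine ContinuousAt.div ?_ (by fun_prop) (by linarith)
    exact (continuous_const.mul (hc.comp (continuous_id.sub continuous_const))).continuousAt
  refine h1.congr ?_
  filter_upwards [Ioi_mem_nhds hx] with y hy
  have hy' : 1 < y := hy
  rw [← hEq (y - 1) (by linarith), sub_add_cancel]
  field_simp [(by linarith : y - 1 ≠ 0)]

/-- The bilinear invariant pairing a solution of Rényi's equation with `renyiAdjoint`. -/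
noncomputable def renyiPairing (F : ℝ → ℝ) (u : ℝ) : ℝ :=
  (∫ t in (0:ℝ)..u, F t) * renyiAdjoint u + ∫ t in u..(u + 1), F t * renyiAdjoint t

theorem renyiPairing_eq {F : ℝ → ℝ} (hF : Measurable F) {A : ℝ}
    (hA : ∀ x, |F x| ≤ A * (|x| + 1))
    (hEq : ∀ x, 0 < x → x * F (x + 1) = 2 * ∫ t in (0:ℝ)..x, F t) {u : ℝ} (hu : 1 ≤ u) :
    renyiPairing F u = renyiPairing F 1 := by
  set Q : ℝ → ℝ := fun t => renyiAdjoint (max t 1) with hQ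
  have hQc : Continuous Q := continuousOn_renyiAdjoint.comp_continuous (by fun_prop)
    fun t => lt_of_lt_of_le one_pos (le_max_right t 1)
  have hQ1 : ∀ t, |Q t| ≤ 1 := fun t => by
    have h1 : 1 ≤ max t 1 := le_max_right t 1
    have h0 : 0 < max t 1 := by linarith
    rw [abs_of_pos (renyiAdjoint_pos h0)]
    exact (renyiAdjoint_le h0).trans (inv_le_one_of_one_le₀ (by nlinarith))
  have hQe : ∀ t, 1 ≤ t → Q t = renyiAdjoint t := fun t ht => by simp [hQ, ht]
  have hFQ : Measurable fun t => F t * Q t := hF.mul hQc.measurable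
  have hAQ : ∀ x, |F x * Q x| ≤ A * (|x| + 1) := fun x => by
    rw [abs_mul]
    exact (mul_le_of_le_one_right (abs_nonneg _) (hQ1 x)).trans (hA x)
  have hint := intervalIntegrable_of_linear_bound hFQ hAQ
  have hc := continuous_primitive_of_linear_bound hF hA
  have hcQ := continuous_primitive_of_linear_bound hFQ hAQ
  set J : ℝ → ℝ := fun u => (∫ t in (0:ℝ)..u, F t) * Q u +
    ((∫ t in (0:ℝ)..(u + 1), F t * Q t) - ∫ t in (0:ℝ)..u, F t * Q t) with hJ
  have hJe : ∀ v, 1 ≤ v → renyiPairing F v = J v := fun v hv => by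
    rw [renyiPairing, hJ]
    simp only
    rw [hQe v hv, intervalIntegral.integral_interval_sub_left (hint _ _) (hint _ _)]
    congr 1
    apply intervalIntegral.integral_congr
    intro t ht
    rw [Set.uIcc_of_le (by linarith)] at ht
    simp only [hQe t (hv.trans ht.1)]
  have hJc : Continuous J :=
    (hc.mul hQc).add ((hcQ.comp (continuous_id.add continuous_const)).sub hcQ)
  have hderiv : ∀ x, 1 < x → HasDerivAt J 0 x := fun x hx => by
    have hFx := continuousAt_of_renyiEq hF hA hEq hx
    have hFx1 := continuousAt_of_renyiEq hF hA hEq (by linarith : 1 < x + 1)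
    have hq : HasDerivAt Q (-2 * renyiAdjoint (x + 1) / x) x := by
      refine (hasDerivAt_renyiAdjoint (by linarith)).congr_of_eventuallyEq ?_
      filter_upwards [Ioi_mem_nhds hx] with y hy
      exact hQe y (le_of_lt hy)
    have h1 := hasDerivAt_primitive_of_linear_bound hF hA hFx
    have h2 := hasDerivAt_primitive_of_linear_bound hFQ hAQ (hFx.mul hQc.continuousAt)
    have h3 := (hasDerivAt_primitive_of_linear_bound hFQ hAQ
      (hFx1.mul hQc.continuousAt)).comp_add_const x 1
    refine ((h1.mul hq).add (h3.sub h2)).congr_deriv ?_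
    have h4 := hEq x (by linarith)
    have h5 : ∫ t in (0:ℝ)..x, F t = x * F (x + 1) / 2 := by linarith
    rw [hQe (x + 1) (by linarith), h5]
    field_simp
    ring
  have h := abs_sub_le_sub_of_abs_deriv_le (f := J) (g := fun _ => 0) hJc.continuousOn
    continuousOn_const hderiv (fun x _ => hasDerivAt_const x 0) (by simp) le_rfl hu
  rw [hJe u hu, hJe 1 le_rfl]
  simpa [sub_eq_zero] using h

theorem renyiPairing_renyiFun : renyiPairing renyiFun 1 = renyiLaplace 1 := by
  have h1 : ∫ t in (0:ℝ)..1, renyiFun t = 1 := by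
    have : ∫ t in (0:ℝ)..1, renyiFun t = ∫ _ in (0:ℝ)..1, (1:ℝ) := by
      apply intervalIntegral.integral_congr
      intro t ht
      rw [Set.uIcc_of_le zero_le_one] at ht
      exact renyiFun_of_le_one ht.2
    rw [this]; simp
  have hderiv : ∀ t ∈ Set.uIcc (1:ℝ) 2, HasDerivAt (fun t => -renyiLaplace t)
      (renyiAdjoint t) t := fun t ht => by
    rw [Set.uIcc_of_le (by norm_num)] at ht
    exact (hasDerivAt_renyiLaplace (by linarith [ht.1])).neg.congr_deriv (neg_neg _)
  have h2 : ∫ t in (1:ℝ)..(1 + 1), renyiFun t * renyiAdjoint t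
      = 2 * (renyiLaplace 1 - renyiLaplace 2) := by
    have h3 : ∫ t in (1:ℝ)..(1 + 1), renyiFun t * renyiAdjoint t
        = ∫ t in (1:ℝ)..2, 2 * renyiAdjoint t := by
      rw [one_add_one_eq_two]
      refine intervalIntegral.integral_congr_ae (Eventually.of_forall fun t ht => ?_)
      rw [Set.uIoc_of_le (by norm_num)] at ht
      rw [renyiFun_eq_two ht.1 ht.2]
    rw [h3, intervalIntegral.integral_const_mul,
      intervalIntegral.integral_eq_sub_of_hasDerivAt hderiv]
    · ring
    · refine (continuousOn_renyiAdjoint.mono fun t ht => ?_).intervalIntegrable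
      rw [Set.uIcc_of_le (by norm_num)] at ht
      exact lt_of_lt_of_le one_pos ht.1
  have h4 := mul_renyiAdjoint zero_le_one
  norm_num at h4
  rw [renyiPairing, h1, h2, h4]
  ring

theorem integral_id_add_one (x : ℝ) : ∫ t in (0:ℝ)..x, (t + 1) = x ^ 2 / 2 + x := by
  rw [intervalIntegral.integral_add (by simp) (by simp)]
  simp

theorem renyiPairing_linear : renyiPairing (fun t => t + 1) 1 = 1 / 2 := by
  have hconst : ∀ u, 1 ≤ u →
      renyiPairing (fun t => t + 1) u = renyiPairing (fun t => t + 1) 1 := fun u hu => by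
    refine renyiPairing_eq (A := 1) (by fun_prop) (fun x => ?_) (fun x _ => ?_) hu
    · simpa using abs_add_le x 1
    · rw [integral_id_add_one]; ring
  have hle : ∀ u : ℝ, 1 ≤ u → 1 / 2 * (u / (u + 2)) ≤ renyiPairing (fun t => t + 1) 1 ∧
      renyiPairing (fun t => t + 1) 1 ≤ 1 / 2 + 2 * u⁻¹ + 2 * (u⁻¹ * u⁻¹) := fun u hu => by
    have hu0 : 0 < u := by linarith
    have hI0 : 0 ≤ ∫ t in u..(u + 1), (t + 1) * renyiAdjoint t :=
      intervalIntegral.integral_nonneg (by linarith) fun t ht => by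
        have := renyiAdjoint_pos (hu0.trans_le ht.1)
        have := ht.1
        have : 0 ≤ t + 1 := by linarith
        positivity
    have hI1 : ∫ t in u..(u + 1), (t + 1) * renyiAdjoint t ≤ (u + 2) * (u ^ 2)⁻¹ := by
      refine (le_abs_self _).trans ?_
      rw [← Real.norm_eq_abs]
      refine (intervalIntegral.norm_integral_le_of_norm_le_const
        (C := (u + 2) * (u ^ 2)⁻¹) fun t ht => ?_).trans (by simp)
      rw [Set.uIoc_of_le (by linarith)] at ht
      have h1 := renyiAdjoint_pos (hu0.trans ht.1)
      have h2 : 0 < t + 1 := by linarith [ht.1]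
      rw [Real.norm_of_nonneg (by positivity)]
      have h3 : renyiAdjoint t ≤ (u ^ 2)⁻¹ :=
        (renyiAdjoint_le_renyiAdjoint hu0 ht.1.le).trans (renyiAdjoint_le hu0)
      have h4 : t + 1 ≤ u + 2 := by linarith [ht.2]
      gcongr
    rw [← hconst u hu, renyiPairing, integral_id_add_one]
    have h5 : 0 < u ^ 2 / 2 + u := by positivity
    constructor
    · calc 1 / 2 * (u / (u + 2)) = (u ^ 2 / 2 + u) * ((u + 2) ^ 2)⁻¹ + 0 := by
            field_simp; ring
        _ ≤ _ := add_le_add (mul_le_mul_of_nonneg_left (le_renyiAdjoint hu0) h5.le) hI0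
    · calc _ ≤ (u ^ 2 / 2 + u) * (u ^ 2)⁻¹ + (u + 2) * (u ^ 2)⁻¹ :=
            add_le_add (mul_le_mul_of_nonneg_left (renyiAdjoint_le hu0) h5.le) hI1
        _ = _ := by field_simp; ring
  have hinv : Tendsto (fun u : ℝ => u⁻¹) atTop (nhds 0) := tendsto_inv_atTop_zero
  apply le_antisymm
  · have hlim : Tendsto (fun u : ℝ => 1 / 2 + 2 * u⁻¹ + 2 * (u⁻¹ * u⁻¹)) atTop (nhds (1 / 2)) := by
      have h := ((hinv.const_mul 2).const_add (1 / 2)).add ((hinv.mul hinv).const_mul 2)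
      simp only [mul_zero, add_zero] at h
      exact h
    refine ge_of_tendsto hlim ?_
    filter_upwards [eventually_ge_atTop 1] with u hu using (hle u hu).2
  · have hlim : Tendsto (fun u : ℝ => 1 / 2 * (1 + 2 * u⁻¹)⁻¹) atTop (nhds (1 / 2)) := by
      have h := ((hinv.const_mul 2).const_add 1)
      simp only [mul_zero, add_zero] at h
      have h' := (h.inv₀ one_ne_zero).const_mul (1 / 2)
      simp only [inv_one, mul_one] at h'
      exact h'
    refine le_of_tendsto hlim ?_
    filter_upwards [eventually_ge_atTop 1] with u hu
    have h1 : (1 + 2 * u⁻¹)⁻¹ = u / (u + 2) := by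
      have hu0 : 0 < u := by linarith
      field_simp
    rw [h1]
    exact (hle u hu).1

theorem renyi_decay {F : ℝ → ℝ} {A : ℝ} (hA : ∀ x, |F x| ≤ A * (|x| + 1))
    (hrec : ∀ u, 1 ≤ u → ∀ B, (∀ t, u ≤ t → t ≤ u + 1 → |F t| ≤ B) → |F (u + 1)| ≤ 2 / u * B)
    (k : ℕ) : ∃ B, ∀ x, 0 ≤ x → |F x| * (x + 1) ^ k ≤ B * (x + 1) := by
  induction k with
  | zero => exact ⟨A, fun x hx => by simpa [abs_of_nonneg hx] using hA x⟩
  | succ k ih =>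
    obtain ⟨B, hB⟩ := ih
    have hB0 : 0 ≤ B := by
      have h := hB 0 le_rfl
      simp only [zero_add, one_pow, mul_one] at h
      exact (abs_nonneg _).trans h
    refine ⟨6 * 2 ^ k * B, fun x hx => ?_⟩
    rcases le_total x 2 with hx2 | hx2
    · calc |F x| * (x + 1) ^ (k + 1) = |F x| * (x + 1) ^ k * (x + 1) := by ring
        _ ≤ B * (x + 1) * 3 := by
          have := hB x hx
          have h3 : x + 1 ≤ 3 := by linarith
          gcongr
        _ ≤ 6 * 2 ^ k * B * (x + 1) := by
          have h2 : (1:ℝ) ≤ 2 ^ k := one_le_pow₀ (by norm_num)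
          have : B * (x + 1) ≤ 2 ^ k * (B * (x + 1)) := le_mul_of_one_le_left (by positivity) h2
          nlinarith [mul_nonneg hB0 (by linarith : 0 ≤ x + 1)]
    · have hx1 : 0 < x - 1 := by linarith
      have h := hrec (x - 1) (by linarith) (B * (x + 1) / x ^ k) fun t ht1 ht2 => by
        rw [le_div_iff₀ (by positivity)]
        calc |F t| * x ^ k ≤ |F t| * (t + 1) ^ k := by
              have : x ≤ t + 1 := by linarith
              gcongr
          _ ≤ B * (t + 1) := hB t (by linarith)
          _ ≤ B * (x + 1) := by gcongr; linarith
      rw [sub_add_cancel] at h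
      have h6 : 2 / (x - 1) * (x + 1) ≤ 6 := by
        rw [div_mul_eq_mul_div, div_le_iff₀ hx1]; linarith
      have h7 : (x + 1) ^ k / x ^ k ≤ 2 ^ k := by
        rw [← div_pow]
        refine pow_le_pow_left₀ (by positivity) ?_ k
        rw [div_le_iff₀ (by linarith)]; linarith
      calc |F x| * (x + 1) ^ (k + 1)
          ≤ 2 / (x - 1) * (B * (x + 1) / x ^ k) * (x + 1) ^ (k + 1) := by gcongr
        _ = (2 / (x - 1) * (x + 1)) * ((x + 1) ^ k / x ^ k) * (B * (x + 1)) := by ring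
        _ ≤ 6 * 2 ^ k * (B * (x + 1)) := by gcongr
        _ = _ := by ring

/-- Rényi's constant. -/
noncomputable def renyiConst : ℝ := ∫ t in Set.Ioi (0:ℝ), renyiWeight t

theorem renyiConst_eq : renyiConst = 2 * renyiLaplace 1 := by
  rw [← renyiLaplace_zero, renyiLaplace, renyiConst]
  simp

/-- The deviation of `renyiFun` from its linear asymptote. -/
noncomputable def renyiError (x : ℝ) : ℝ := renyiFun x - renyiConst * (x + 1)

theorem measurable_renyiError : Measurable renyiError :=
  measurable_renyiFun.sub (by fun_prop)

theorem abs_renyiError_le (x : ℝ) : |renyiError x| ≤ (1 + |renyiConst|) * (|x| + 1) := by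
  have h1 := abs_renyiFun_le x
  have h2 : |renyiConst * (x + 1)| ≤ |renyiConst| * (|x| + 1) := by
    rw [abs_mul]
    gcongr
    simpa using abs_add_le x 1
  calc _ ≤ |renyiFun x| + |renyiConst * (x + 1)| := abs_sub _ _
    _ ≤ _ := by linarith

theorem mul_renyiError_add_one {x : ℝ} (hx : 0 < x) :
    x * renyiError (x + 1) = 2 * ∫ t in (0:ℝ)..x, renyiError t := by
  have h1 : ∫ t in (0:ℝ)..x, renyiError t
      = (∫ t in (0:ℝ)..x, renyiFun t) - renyiConst * (x ^ 2 / 2 + x) := by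
    rw [← integral_id_add_one, ← intervalIntegral.integral_const_mul]
    refine intervalIntegral.integral_sub ?_ (Continuous.intervalIntegrable (by fun_prop) _ _)
    exact intervalIntegrable_of_linear_bound measurable_renyiFun (A := 1)
      (by simpa using abs_renyiFun_le) _ _
  rw [h1, mul_sub, ← mul_renyiFun_add_one hx, renyiError]
  ring

theorem renyiPairing_renyiError {u : ℝ} (hu : 1 ≤ u) : renyiPairing renyiError u = 0 := by
  rw [renyiPairing_eq measurable_renyiError abs_renyiError_le
    (fun x => mul_renyiError_add_one) hu]
  have hq : ContinuousOn renyiAdjoint (Set.uIcc (1:ℝ) (1 + 1)) :=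
    continuousOn_renyiAdjoint.mono fun t ht => by
      rw [Set.uIcc_of_le (by norm_num)] at ht
      exact lt_of_lt_of_le one_pos ht.1
  have hN : ∀ a b, IntervalIntegrable renyiFun volume a b :=
    intervalIntegrable_of_linear_bound measurable_renyiFun (A := 1) (by simpa using abs_renyiFun_le)
  have hL : ∀ a b, IntervalIntegrable (fun t : ℝ => renyiConst * (t + 1)) volume a b :=
    fun a b => Continuous.intervalIntegrable (by fun_prop) _ _
  have h1 : renyiPairing renyiError 1 = renyiPairing renyiFun 1
      - renyiConst * renyiPairing (fun t => t + 1) 1 := by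
    simp only [renyiPairing, renyiError]
    have h2 : ∀ t, (renyiFun t - renyiConst * (t + 1)) * renyiAdjoint t
        = renyiFun t * renyiAdjoint t - renyiConst * ((t + 1) * renyiAdjoint t) := fun t => by ring
    have h3 : IntervalIntegrable (fun t => (t + 1) * renyiAdjoint t) volume 1 (1 + 1) :=
      (ContinuousOn.mul (by fun_prop) hq).intervalIntegrable
    simp only [h2]
    rw [intervalIntegral.integral_sub (hN _ _) (hL _ _),
      intervalIntegral.integral_sub ((hN _ _).mul_continuousOn hq) (h3.const_mul _),
      intervalIntegral.integral_const_mul, intervalIntegral.integral_const_mul]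
    ring
  rw [h1, renyiPairing_renyiFun, renyiPairing_linear, renyiConst_eq]
  ring

theorem abs_renyiError_add_one_le {u : ℝ} (hu : 1 ≤ u) (B : ℝ)
    (hB : ∀ t, u ≤ t → t ≤ u + 1 → |renyiError t| ≤ B) : |renyiError (u + 1)| ≤ 2 / u * B := by
  have hu0 : 0 < u := by linarith
  have hq0 := renyiAdjoint_pos hu0
  have h := renyiPairing_renyiError hu
  have h1 : |∫ t in u..(u + 1), renyiError t * renyiAdjoint t| ≤ B * renyiAdjoint u := by
    rw [← Real.norm_eq_abs]
    refine (intervalIntegral.norm_integral_le_of_norm_le_const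
      (C := B * renyiAdjoint u) fun t ht => ?_).trans (by simp)
    rw [Set.uIoc_of_le (by linarith)] at ht
    have h2 := renyiAdjoint_pos (hu0.trans ht.1)
    rw [norm_mul, Real.norm_eq_abs, Real.norm_of_nonneg h2.le]
    have h3 := hB t ht.1.le ht.2
    have h4 := renyiAdjoint_le_renyiAdjoint hu0 ht.1.le
    have h5 := (abs_nonneg _).trans h3
    gcongr
  have h2 : ∫ t in (0:ℝ)..u, renyiError t = u / 2 * renyiError (u + 1) := by
    linarith [mul_renyiError_add_one hu0]
  rw [renyiPairing, h2] at h
  have h3 : |u / 2 * renyiError (u + 1) * renyiAdjoint u| ≤ B * renyiAdjoint u := by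
    rw [eq_neg_of_add_eq_zero_left h, abs_neg]
    exact h1
  rw [abs_mul, abs_mul, abs_of_pos hq0, abs_of_pos (by positivity)] at h3
  have h4 := le_of_mul_le_mul_right h3 hq0
  rw [div_mul_eq_mul_div, le_div_iff₀ hu0]
  linarith

theorem exists_renyiError_bound :
    ∃ K, 0 < K ∧ ∀ x, 0 ≤ x → |renyiError x| ≤ K / (x + 1) ^ 4 := by
  obtain ⟨B, hB⟩ := renyi_decay abs_renyiError_le (fun u hu B h => abs_renyiError_add_one_le hu B h) 5
  refine ⟨|B| + 1, by positivity, fun x hx => ?_⟩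
  rw [le_div_iff₀ (by positivity)]
  have h := hB x hx
  have h1 : |renyiError x| * (x + 1) ^ 4 * (x + 1) ≤ B * (x + 1) := by
    calc _ = |renyiError x| * (x + 1) ^ 5 := by ring
      _ ≤ _ := h
  have h2 := le_of_mul_le_mul_right h1 (by linarith)
  linarith [le_abs_self B]

/-- The kernel of the exponential parking equation, symmetrised under `t ↦ x - t`. -/
noncomputable def expKernel (lam x t : ℝ) : ℝ :=
  lam * (Real.exp (-(lam * t)) + Real.exp (-(lam * (x - t)))) / (1 - Real.exp (-(lam * x)))

theorem one_sub_exp_neg_pos {lam x : ℝ} (hl : 0 < lam) (hx : 0 < x) :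
    0 < 1 - Real.exp (-(lam * x)) := by
  have : Real.exp (-(lam * x)) < 1 := Real.exp_lt_one_iff.2 (by nlinarith)
  linarith

theorem expKernel_nonneg {lam x : ℝ} (hl : 0 < lam) (hx : 0 < x) (t : ℝ) :
    0 ≤ expKernel lam x t := by
  have := one_sub_exp_neg_pos hl hx
  unfold expKernel
  positivity

theorem continuous_expKernel (lam x : ℝ) : Continuous (expKernel lam x) := by
  unfold expKernel
  fun_prop

theorem integral_mul_exp_neg_mul (lam x : ℝ) :
    ∫ t in (0:ℝ)..x, lam * Real.exp (-(lam * t)) = 1 - Real.exp (-(lam * x)) := by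
  have h : ∀ t ∈ Set.uIcc 0 x, HasDerivAt (fun t => -Real.exp (-(lam * t)))
      (lam * Real.exp (-(lam * t))) t := fun t _ => by
    have h1 : HasDerivAt (fun t : ℝ => -(lam * t)) (-(lam * 1)) t :=
      ((hasDerivAt_id t).const_mul lam).neg
    refine h1.exp.neg.congr_deriv ?_
    ring
  rw [intervalIntegral.integral_eq_sub_of_hasDerivAt h
    (Continuous.intervalIntegrable (by fun_prop) _ _)]
  simp
  ring

theorem integral_comp_reflect (f : ℝ → ℝ) (x : ℝ) :
    ∫ t in (0:ℝ)..x, f (x - t) = ∫ t in (0:ℝ)..x, f t := by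
  simp

theorem integral_expKernel {lam x : ℝ} (hl : 0 < lam) (hx : 0 < x) :
    ∫ t in (0:ℝ)..x, expKernel lam x t = 2 := by
  have h0 := one_sub_exp_neg_pos hl hx
  have h1 := integral_mul_exp_neg_mul lam x
  have h2 := integral_comp_reflect (fun t => lam * Real.exp (-(lam * t))) x
  simp only [expKernel, mul_add, add_div]
  rw [intervalIntegral.integral_add (Continuous.intervalIntegrable (by fun_prop) _ _)
    (Continuous.intervalIntegrable (by fun_prop) _ _), intervalIntegral.integral_div,
    intervalIntegral.integral_div, h2, h1, div_self h0.ne']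
  norm_num

theorem expKernel_reflect (lam x t : ℝ) : expKernel lam x (x - t) = expKernel lam x t := by
  simp [expKernel, add_comm]

theorem integral_expKernel_mul_id {lam x : ℝ} (hl : 0 < lam) (hx : 0 < x) :
    ∫ t in (0:ℝ)..x, expKernel lam x t * t = x := by
  have hk := continuous_expKernel lam x
  have h1 := integral_comp_reflect (fun t => expKernel lam x t * t) x
  simp only [expKernel_reflect, mul_sub] at h1
  rw [intervalIntegral.integral_sub (Continuous.intervalIntegrable (by fun_prop) _ _)
    (Continuous.intervalIntegrable (by fun_prop) _ _), intervalIntegral.integral_mul_const,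
    integral_expKernel hl hx] at h1
  linarith

theorem abs_expKernel_sub_le {lam x t : ℝ} (hl : 0 < lam) (hx : 0 < x) (ht0 : 0 ≤ t)
    (htx : t ≤ x) : |expKernel lam x t - expKernel lam x 0| ≤ lam ^ 2 * t := by
  have h0 := one_sub_exp_neg_pos hl hx
  have hxt : Real.exp (-(lam * x)) = Real.exp (-(lam * t)) * Real.exp (-(lam * (x - t))) := by
    rw [← Real.exp_add]; ring_nf
  have ha1 : Real.exp (-(lam * t)) ≤ 1 := Real.exp_le_one_iff.2 (by nlinarith)
  have hb1 : Real.exp (-(lam * (x - t))) ≤ 1 := Real.exp_le_one_iff.2 (by nlinarith)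
  have ha0 := Real.exp_pos (-(lam * t))
  have hb0 := Real.exp_pos (-(lam * (x - t)))
  have hat := Real.add_one_le_exp (-(lam * t))
  have h : expKernel lam x t - expKernel lam x 0
      = -(lam * ((1 - Real.exp (-(lam * t))) * (1 - Real.exp (-(lam * (x - t)))))
        / (1 - Real.exp (-(lam * x)))) := by
    rw [expKernel, expKernel, ← sub_div, ← neg_div]
    congr 1
    simp only [mul_zero, neg_zero, Real.exp_zero, sub_zero]
    rw [hxt]
    ring
  rw [h, abs_neg, abs_of_nonneg (div_nonneg (mul_nonneg hl.le
    (mul_nonneg (by linarith) (by linarith))) h0.le), div_le_iff₀ h0]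
  have h1 : 1 - Real.exp (-(lam * (x - t))) ≤ 1 - Real.exp (-(lam * x)) := by
    rw [hxt]; nlinarith
  have h2 : 1 - Real.exp (-(lam * t)) ≤ lam * t := by linarith
  calc lam * ((1 - Real.exp (-(lam * t))) * (1 - Real.exp (-(lam * (x - t)))))
      ≤ lam * ((lam * t) * (1 - Real.exp (-(lam * x)))) := by
        gcongr
    _ = _ := by ring

/-- `F` is a solution of the exponential parking equation, in the homogeneous form satisfied by
`M + 1`. -/
structure IsExpParkingSol (lam : ℝ) (F : ℝ → ℝ) : Prop where
  measurable : Measurable F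
  abs_le : ∀ x, |F x| ≤ |x| + 1
  eq_one : ∀ x, 0 ≤ x → x ≤ 1 → F x = 1
  eq_integral : ∀ x, 0 < x → F (x + 1) = ∫ t in (0:ℝ)..x, expKernel lam x t * F t

theorem isExpParkingSol_of_satisfies {lam : ℝ} (hl : 0 < lam) {M : ℝ → ℝ} (hm : Measurable M)
    (hb : ∀ x : ℝ, 0 ≤ x → 0 ≤ M x ∧ M x ≤ x) (hM : SatisfiesExpParkingEq lam M) :
    IsExpParkingSol lam (fun x => if 0 ≤ x then M x + 1 else 1) := by
  set F : ℝ → ℝ := fun x => if 0 ≤ x then M x + 1 else 1 with hF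
  have hFm : Measurable F := Measurable.ite measurableSet_Ici (hm.add_const 1) measurable_const
  have hFb : ∀ x, |F x| ≤ |x| + 1 := fun x => by
    simp only [hF]
    split_ifs with h
    · have := hb x h
      rw [abs_of_nonneg (by linarith), abs_of_nonneg h]
      linarith
    · simp
  have hFM : ∀ x, 0 ≤ x → F x = M x + 1 := fun x hx => if_pos hx
  refine ⟨hFm, hFb, fun x h0 h1 => ?_, fun x hx => ?_⟩
  · rw [hFM x h0, hM.1 x h0 h1, zero_add]
  · have h0 := one_sub_exp_neg_pos hl hx
    set p : ℝ → ℝ := fun t => lam * Real.exp (-(lam * t)) / (1 - Real.exp (-(lam * x))) with hp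
    have hpc : Continuous p := by fun_prop
    have hp1 : ∫ t in (0:ℝ)..x, p t = 1 := by
      rw [hp, intervalIntegral.integral_div, integral_mul_exp_neg_mul, div_self h0.ne']
    have hi : ∀ a b, IntervalIntegrable F volume a b :=
      intervalIntegrable_of_linear_bound hFm (A := 1) (by simpa using hFb)
    have hi1 : IntervalIntegrable (fun t => p t * F t) volume 0 x :=
      (hi 0 x).continuousOn_mul hpc.continuousOn
    have hi2 : IntervalIntegrable (fun t => p (x - t) * F t) volume 0 x :=
      (hi 0 x).continuousOn_mul (hpc.comp (continuous_const.sub continuous_id)).continuousOn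
    have hi3 : IntervalIntegrable (fun t => p t * F (x - t)) volume 0 x := by
      have h := (hi2.comp_sub_left x).symm
      simpa using h
    have hr : ∫ t in (0:ℝ)..x, p t * F (x - t) = ∫ t in (0:ℝ)..x, p (x - t) * F t := by
      rw [← integral_comp_reflect (fun t => p (x - t) * F t)]
      simp
    have h1 : ∫ t in (0:ℝ)..x, (lam * Real.exp (-lam * t) / (1 - Real.exp (-lam * x)))
        * (M t + M (x - t)) = ∫ t in (0:ℝ)..x, ((p t * F t + p t * F (x - t)) - 2 * p t) := by
      apply intervalIntegral.integral_congr
      intro t ht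
      rw [Set.uIcc_of_le hx.le] at ht
      simp only [hp, hFM t ht.1, hFM (x - t) (by linarith [ht.2]), neg_mul]
      ring
    have h2 : ∀ t, expKernel lam x t * F t = p t * F t + p (x - t) * F t := fun t => by
      simp only [hp, expKernel]; ring
    simp only [h2]
    rw [hFM _ (by linarith), hM.2 x hx, h1, intervalIntegral.integral_sub (hi1.add hi3)
      (Continuous.intervalIntegrable (by fun_prop) _ _), intervalIntegral.integral_add hi1 hi3, hr,
      intervalIntegral.integral_add hi1 hi2, intervalIntegral.integral_const_mul, hp1]
    ring

/-- The defect of `renyiError` in the exponential parking equation is of order `lam ^ 2`. -/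
theorem abs_expKernel_defect_le {K : ℝ} (hK : 0 < K)
    (hD : ∀ x, 0 ≤ x → |renyiError x| ≤ K / (x + 1) ^ 4) {lam x : ℝ} (hl : 0 < lam) (hx : 0 < x) :
    |(∫ t in (0:ℝ)..x, expKernel lam x t * renyiError t) - renyiError (x + 1)|
      ≤ 2 * K * lam ^ 2 := by
  have hk := continuous_expKernel lam x
  have hi : ∀ a b, IntervalIntegrable renyiError volume a b :=
    intervalIntegrable_of_linear_bound measurable_renyiError abs_renyiError_le
  have hS : x * renyiError (x + 1) = 2 * ∫ t in (0:ℝ)..x, renyiError t := mul_renyiError_add_one hx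
  set k0 := expKernel lam x 0 with hk0
  have h1 : (∫ t in (0:ℝ)..x, expKernel lam x t * renyiError t) - renyiError (x + 1)
      = (∫ t in (0:ℝ)..x, (expKernel lam x t - k0) * renyiError t)
        + (k0 * x - 2) * (renyiError (x + 1) / 2) := by
    simp only [sub_mul]
    rw [intervalIntegral.integral_sub ((hi 0 x).continuousOn_mul hk.continuousOn)
      ((hi 0 x).const_mul k0), intervalIntegral.integral_const_mul,
      (by linarith : ∫ t in (0:ℝ)..x, renyiError t = x * renyiError (x + 1) / 2)]
    ring
  have h2 : |k0 * x - 2| ≤ lam ^ 2 * x * x := by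
    have h : k0 * x - 2 = ∫ t in (0:ℝ)..x, (k0 - expKernel lam x t) := by
      rw [intervalIntegral.integral_sub (by simp) (hk.intervalIntegrable _ _),
        integral_expKernel hl hx]
      simp
      ring
    rw [h, ← Real.norm_eq_abs]
    refine (intervalIntegral.norm_integral_le_of_norm_le_const
      (C := lam ^ 2 * x) fun t ht => ?_).trans (by simp [abs_of_pos hx])
    rw [Set.uIoc_of_le hx.le] at ht
    rw [norm_sub_rev, Real.norm_eq_abs]
    refine (abs_expKernel_sub_le hl hx ht.1.le ht.2).trans ?_
    gcongr
    exact ht.2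
  have hden : ∀ t ∈ Set.uIcc 0 x, (t + 1) ≠ 0 := fun t ht => by
    rw [Set.uIcc_of_le hx.le] at ht
    linarith [ht.1]
  have hii : IntervalIntegrable (fun t : ℝ => lam ^ 2 * K * (1 / (t + 1) ^ 2)) volume 0 x := by
    refine ContinuousOn.intervalIntegrable ?_
    refine continuousOn_const.mul (continuousOn_const.div (by fun_prop) fun t ht => ?_)
    exact pow_ne_zero 2 (hden t ht)
  have h3 : |∫ t in (0:ℝ)..x, (expKernel lam x t - k0) * renyiError t| ≤ K * lam ^ 2 := by
    have hb : |∫ t in (0:ℝ)..x, (expKernel lam x t - k0) * renyiError t|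
        ≤ ∫ t in (0:ℝ)..x, lam ^ 2 * K * (1 / (t + 1) ^ 2) := by
      rw [← Real.norm_eq_abs]
      refine intervalIntegral.norm_integral_le_of_norm_le hx.le
        (Eventually.of_forall fun t ht => ?_) hii
      have ht0 : 0 < t := ht.1
      rw [norm_mul, Real.norm_eq_abs, Real.norm_eq_abs]
      calc |expKernel lam x t - k0| * |renyiError t|
          ≤ (lam ^ 2 * t) * (K / (t + 1) ^ 4) := by
            gcongr
            · exact abs_expKernel_sub_le hl hx ht0.le ht.2
            · exact hD t ht0.le
        _ = lam ^ 2 * K * (t / (t + 1) ^ 4) := by ring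
        _ ≤ lam ^ 2 * K * (1 / (t + 1) ^ 2) := by
            gcongr lam ^ 2 * K * ?_
            rw [div_le_div_iff₀ (by positivity) (by positivity)]
            have : 0 ≤ (t + 1) ^ 2 * (t ^ 2 + t + 1) := by positivity
            nlinarith
    refine hb.trans ?_
    have hd : ∀ t ∈ Set.uIcc 0 x,
        HasDerivAt (fun t : ℝ => -(t + 1)⁻¹) (1 / (t + 1) ^ 2) t := fun t ht => by
      have h := (((hasDerivAt_id t).add_const 1).inv (hden t ht)).neg
      refine h.congr_deriv ?_
      simp only [id]
      ring
    rw [intervalIntegral.integral_const_mul, intervalIntegral.integral_eq_sub_of_hasDerivAt hd]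
    · have : 0 < (x + 1)⁻¹ := by positivity
      have h4 : -(x + 1)⁻¹ - -((0:ℝ) + 1)⁻¹ ≤ 1 := by norm_num; linarith
      calc _ ≤ lam ^ 2 * K * 1 := by gcongr
        _ = _ := by ring
    · refine ContinuousOn.intervalIntegrable ?_
      exact continuousOn_const.div (by fun_prop) fun t ht => pow_ne_zero 2 (hden t ht)
  have h4 : |(k0 * x - 2) * (renyiError (x + 1) / 2)| ≤ K * lam ^ 2 := by
    rw [abs_mul, abs_div, abs_two]
    have h5 := hD (x + 1) (by linarith)
    calc _ ≤ (lam ^ 2 * x * x) * ((K / (x + 1 + 1) ^ 4) / 2) := by gcongr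
      _ = K * lam ^ 2 * (x ^ 2 / (2 * (x + 1 + 1) ^ 4)) := by field_simp
      _ ≤ K * lam ^ 2 * 1 := by
        gcongr
        rw [div_le_one (by positivity)]
        have h6 : x ^ 2 ≤ (x + 1 + 1) ^ 2 := by gcongr; linarith
        have h7 : 1 ≤ (x + 1 + 1) ^ 2 := one_le_pow₀ (by linarith)
        nlinarith
      _ = _ := mul_one _
  rw [h1]
  refine (abs_add_le _ _).trans ?_
  linarith

theorem abs_sub_renyiFun_le {K : ℝ} (hK : 0 < K)
    (hD : ∀ x, 0 ≤ x → |renyiError x| ≤ K / (x + 1) ^ 4) {lam : ℝ} (hl : 0 < lam) {F : ℝ → ℝ}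
    (hF : IsExpParkingSol lam F) {x : ℝ} (hx : 0 ≤ x) :
    |F x - renyiFun x| ≤ 2 * K * lam ^ 2 * x := by
  have key : ∀ n : ℕ, ∀ x : ℝ, 0 ≤ x → x ≤ n + 1 → |F x - renyiFun x| ≤ 2 * K * lam ^ 2 * x := by
    have hsmall : ∀ x : ℝ, 0 ≤ x → x ≤ 1 → |F x - renyiFun x| ≤ 2 * K * lam ^ 2 * x :=
      fun x hx0 hx1 => by
        rw [hF.eq_one x hx0 hx1, renyiFun_of_le_one hx1, sub_self, abs_zero]
        positivity
    intro n
    induction n with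
    | zero => intro x hx0 hx1; exact hsmall x hx0 (by simpa using hx1)
    | succ n ih =>
      intro x hx0 hx1
      push_cast at hx1
      rcases le_or_gt x 1 with h | h
      · exact hsmall x hx0 h
      obtain ⟨y, rfl⟩ : ∃ y, x = y + 1 := ⟨x - 1, by ring⟩
      have hy : 0 < y := by linarith
      have hk := continuous_expKernel lam y
      have hiF : IntervalIntegrable F volume 0 y :=
        intervalIntegrable_of_linear_bound hF.measurable (A := 1) (by simpa using hF.abs_le) _ _
      have hiN : IntervalIntegrable renyiFun volume 0 y :=
        intervalIntegrable_of_linear_bound measurable_renyiFun (A := 1)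
          (by simpa using abs_renyiFun_le) _ _
      have hiE : IntervalIntegrable renyiError volume 0 y :=
        intervalIntegrable_of_linear_bound measurable_renyiError abs_renyiError_le _ _
      have hlin : ∫ t in (0:ℝ)..y, (expKernel lam y t * renyiFun t - expKernel lam y t * renyiError t)
          = renyiConst * (y + 2) := by
        have h1 : ∀ t, expKernel lam y t * renyiFun t - expKernel lam y t * renyiError t
            = renyiConst * (expKernel lam y t * t + expKernel lam y t) := fun t => by
          rw [renyiError]; ring
        simp only [h1]
        rw [intervalIntegral.integral_const_mul, intervalIntegral.integral_add
          (Continuous.intervalIntegrable (by fun_prop) _ _) (hk.intervalIntegrable _ _),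
          integral_expKernel_mul_id hl hy, integral_expKernel hl hy]
      rw [intervalIntegral.integral_sub (hiN.continuousOn_mul hk.continuousOn)
        (hiE.continuousOn_mul hk.continuousOn)] at hlin
      have hsplit : F (y + 1) - renyiFun (y + 1)
          = (∫ t in (0:ℝ)..y, expKernel lam y t * (F t - renyiFun t))
            + ((∫ t in (0:ℝ)..y, expKernel lam y t * renyiError t) - renyiError (y + 1)) := by
        simp only [mul_sub]
        rw [intervalIntegral.integral_sub (hiF.continuousOn_mul hk.continuousOn)
          (hiN.continuousOn_mul hk.continuousOn), ← hF.eq_integral y hy, renyiError]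
        linear_combination hlin
      have hb : |∫ t in (0:ℝ)..y, expKernel lam y t * (F t - renyiFun t)|
          ≤ 2 * K * lam ^ 2 * y := by
        calc _ ≤ ∫ t in (0:ℝ)..y, 2 * K * lam ^ 2 * (expKernel lam y t * t) := by
              rw [← Real.norm_eq_abs]
              refine intervalIntegral.norm_integral_le_of_norm_le hy.le
                (Eventually.of_forall fun t ht => ?_)
                (Continuous.intervalIntegrable (by fun_prop) _ _)
              have h1 := ih t ht.1.le (by linarith [ht.2])
              have h2 := expKernel_nonneg hl hy t
              rw [norm_mul, Real.norm_of_nonneg h2, Real.norm_eq_abs]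
              calc _ ≤ expKernel lam y t * (2 * K * lam ^ 2 * t) := by gcongr
                _ = _ := by ring
          _ = _ := by rw [intervalIntegral.integral_const_mul, integral_expKernel_mul_id hl hy]
      rw [hsplit]
      refine (abs_add_le _ _).trans ?_
      have := abs_expKernel_defect_le hK hD hl hy
      linarith
  exact key ⌈x⌉₊ x hx (by linarith [Nat.le_ceil x])

theorem hasDerivAt_primitive_mul {w D : ℝ → ℝ} (hw : Continuous w) (hD : Measurable D)
    (hi : ∀ a b, IntervalIntegrable D volume a b) {x : ℝ} (hx : ContinuousAt D x) :
    HasDerivAt (fun y => ∫ t in (0:ℝ)..y, w t * D t) (w x * D x) x :=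
  intervalIntegral.integral_hasDerivAt_right ((hi 0 x).continuousOn_mul hw.continuousOn)
    (hw.measurable.mul hD).stronglyMeasurable.stronglyMeasurableAtFilter (hw.continuousAt.mul hx)

theorem continuous_primitive_mul {w D : ℝ → ℝ} (hw : Continuous w)
    (hi : ∀ a b, IntervalIntegrable D volume a b) :
    Continuous (fun y => ∫ t in (0:ℝ)..y, w t * D t) :=
  intervalIntegral.continuous_primitive (fun a b => (hi a b).continuousOn_mul hw.continuousOn) 0

theorem hasDerivAt_exp_mul (a x : ℝ) :
    HasDerivAt (fun t : ℝ => Real.exp (a * t)) (a * Real.exp (a * x)) x := by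
  have h : HasDerivAt (fun t : ℝ => a * t) (a * 1) x := (hasDerivAt_id x).const_mul a
  refine h.exp.congr_deriv ?_
  ring

theorem tendsto_exp_neg_mul_atTop {lam : ℝ} (hl : 0 < lam) :
    Tendsto (fun x : ℝ => Real.exp (-(lam * x))) atTop (nhds 0) :=
  Real.tendsto_exp_neg_atTop_nhds_zero.comp (tendsto_id.const_mul_atTop hl)

/-- The exponentially weighted running mean of `D`. -/
noncomputable def expMean (lam : ℝ) (D : ℝ → ℝ) (x : ℝ) : ℝ :=
  Real.exp (-(lam * x)) * ∫ t in (0:ℝ)..x, lam * Real.exp (lam * t) * D t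

/-- The truncated exponential average of `D`. -/
noncomputable def expHead (lam : ℝ) (D : ℝ → ℝ) (x : ℝ) : ℝ :=
  ∫ t in (0:ℝ)..x, lam * Real.exp (-(lam * t)) * D t

theorem tendsto_expMean {lam : ℝ} (hl : 0 < lam) {D : ℝ → ℝ}
    (hi : ∀ a b, IntervalIntegrable D volume a b) {δ : ℝ} (hlim : Tendsto D atTop (nhds δ)) :
    Tendsto (expMean lam D) atTop (nhds δ) := by
  rw [Metric.tendsto_atTop]
  intro ε hε
  obtain ⟨X, hX⟩ := Metric.tendsto_atTop.1 hlim (ε / 2) (by linarith)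
  have hwc : Continuous fun t : ℝ => lam * Real.exp (lam * t) := by fun_prop
  set w : ℝ → ℝ := fun y => ∫ t in (0:ℝ)..y, lam * Real.exp (lam * t) * D t with hw
  have hexp : ∀ a b, ∫ t in a..b, lam * Real.exp (lam * t)
      = Real.exp (lam * b) - Real.exp (lam * a) := fun a b =>
    intervalIntegral.integral_eq_sub_of_hasDerivAt (fun t _ => hasDerivAt_exp_mul lam t)
      (hwc.intervalIntegrable _ _)
  have hmain : ∀ y, X ≤ y →
      |w y - w X - δ * (Real.exp (lam * y) - Real.exp (lam * X))|
        ≤ ε / 2 * (Real.exp (lam * y) - Real.exp (lam * X)) := fun y hy => by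
    have hii : ∀ a b, IntervalIntegrable (fun t => lam * Real.exp (lam * t) * D t) volume a b :=
      fun a b => (hi a b).continuousOn_mul hwc.continuousOn
    have h1 : w y - w X - δ * (Real.exp (lam * y) - Real.exp (lam * X))
        = ∫ t in X..y, lam * Real.exp (lam * t) * (D t - δ) := by
      simp only [mul_sub]
      rw [intervalIntegral.integral_sub (hii _ _) ((hwc.intervalIntegrable _ _).mul_const _),
        intervalIntegral.integral_mul_const, hexp, hw]
      simp only
      rw [intervalIntegral.integral_interval_sub_left (hii _ _) (hii _ _)]
      ring
    rw [h1, ← hexp, ← intervalIntegral.integral_const_mul, ← Real.norm_eq_abs]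
    refine intervalIntegral.norm_integral_le_of_norm_le hy (Eventually.of_forall fun t ht => ?_)
      (Continuous.intervalIntegrable (by fun_prop) _ _)
    have h2 := hX t ht.1.le
    rw [Real.dist_eq] at h2
    have h3 : 0 < lam * Real.exp (lam * t) := by positivity
    rw [norm_mul, Real.norm_of_nonneg h3.le, Real.norm_eq_abs, mul_comm]
    gcongr
  have hsmall : Tendsto (fun y => Real.exp (-(lam * y)) * |w X - δ * Real.exp (lam * X)|) atTop
      (nhds 0) := by
    simpa using (tendsto_exp_neg_mul_atTop hl).mul_const |w X - δ * Real.exp (lam * X)|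
  have hev := (hsmall.eventually_lt_const (by linarith : 0 < ε / 2)).and (eventually_ge_atTop X)
  obtain ⟨Y, hY⟩ := eventually_atTop.1 hev
  refine ⟨Y, fun y hy => ?_⟩
  obtain ⟨h1, h2⟩ := hY y hy
  have h3 := hmain y h2
  rw [Real.dist_eq]
  have he : Real.exp (-(lam * y)) * Real.exp (lam * y) = 1 := by rw [← Real.exp_add]; simp
  have hpos := Real.exp_pos (-(lam * y))
  have h4 : expMean lam D y - δ = Real.exp (-(lam * y)) *
      (w y - w X - δ * (Real.exp (lam * y) - Real.exp (lam * X)))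
      + Real.exp (-(lam * y)) * (w X - δ * Real.exp (lam * X)) := by
    rw [expMean]
    linear_combination δ * he
  have h5 : Real.exp (-(lam * y)) * |w y - w X - δ * (Real.exp (lam * y) - Real.exp (lam * X))|
      ≤ ε / 2 := by
    calc _ ≤ Real.exp (-(lam * y)) * (ε / 2 * Real.exp (lam * y)) := by
          gcongr
          refine h3.trans ?_
          gcongr
          linarith [Real.exp_pos (lam * X)]
      _ = ε / 2 := by linear_combination (ε / 2) * he
  rw [h4]
  refine (abs_add_le _ _).trans_lt ?_
  rw [abs_mul, abs_mul, abs_of_pos hpos]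
  linarith

/-- The limit of a solution of the homogeneous exponential parking equation is `O(lam)`, provided
the solution is close to an integrable profile up to an error of order `lam ^ 2 * (x + 1)`. -/
theorem abs_limit_le {lam K δ : ℝ} (hl : 0 < lam) (hl1 : lam ≤ 1) (hK : 0 < K) {D : ℝ → ℝ}
    (hDm : Measurable D) (hi : ∀ a b, IntervalIntegrable D volume a b)
    (heq : ∀ x, 0 < x →
      (1 - Real.exp (-(lam * x))) * D (x + 1) = expHead lam D x + expMean lam D x)
    (hlim : Tendsto D atTop (nhds δ))
    (hb : ∀ x, 0 ≤ x → |D x| ≤ K / (x + 1) ^ 2 + 2 * K * lam ^ 2 * (x + 1)) :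
    |δ| ≤ 48 * K * lam := by
  have hw1 : Continuous fun t : ℝ => lam * Real.exp (lam * t) := by fun_prop
  have hw2 : Continuous fun t : ℝ => lam * Real.exp (-(lam * t)) := by fun_prop
  have hHc : Continuous (expHead lam D) := continuous_primitive_mul hw2 hi
  have hGc : Continuous (expMean lam D) :=
    (by fun_prop : Continuous fun x : ℝ => Real.exp (-(lam * x))).mul
      (continuous_primitive_mul hw1 hi)
  have hDc : ∀ x, 1 < x → ContinuousAt D x := fun x hx => by
    have h1 : ContinuousAt (fun y => (expHead lam D (y - 1) + expMean lam D (y - 1))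
        / (1 - Real.exp (-(lam * (y - 1))))) x := by
      refine ContinuousAt.div ?_ (by fun_prop)
        (one_sub_exp_neg_pos hl (by linarith : 0 < x - 1)).ne'
      exact ((hHc.add hGc).comp (continuous_id.sub continuous_const)).continuousAt
    refine h1.congr ?_
    filter_upwards [Ioi_mem_nhds hx] with y hy
    have hy' : 0 < y - 1 := sub_pos.2 hy
    rw [← heq (y - 1) hy', sub_add_cancel]
    field_simp [(one_sub_exp_neg_pos hl hy').ne']
  have hGlim := tendsto_expMean hl hi hlim
  have hDlim1 : Tendsto (fun x => D (x + 1)) atTop (nhds δ) :=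
    hlim.comp (tendsto_atTop_add_const_right _ _ tendsto_id)
  have hHlim : Tendsto (expHead lam D) atTop (nhds 0) := by
    have h := (((tendsto_exp_neg_mul_atTop hl).const_sub 1).mul hDlim1).sub hGlim
    simp only [sub_zero, one_mul, sub_self] at h
    refine h.congr' ?_
    filter_upwards [eventually_gt_atTop 0] with x hx
    rw [heq x hx]
    ring
  have hexpd : ∀ x : ℝ, HasDerivAt (fun t : ℝ => Real.exp (-(lam * t)))
      (-(lam * Real.exp (-(lam * x)))) x := fun x => by
    simpa only [neg_mul] using hasDerivAt_exp_mul (-lam) x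
  have hinvd : ∀ x : ℝ, 1 < x → HasDerivAt (fun t : ℝ => (t + 1)⁻¹) (-((x + 1) ^ 2)⁻¹) x :=
    fun x hx => by
      have h := ((hasDerivAt_id x).add_const 1).inv (by simp only [id]; linarith)
      refine h.congr_deriv ?_
      simp only [id]
      rw [neg_div, one_div]
  have hlin : ∀ x : ℝ, HasDerivAt (fun t : ℝ => t + 1) 1 x :=
    fun x => (hasDerivAt_id x).add_const 1
  have hinvc : ContinuousOn (fun t : ℝ => (t + 1)⁻¹) (Set.Ici 1) :=
    ContinuousOn.inv₀ (by fun_prop) fun t ht => by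
      have : (1:ℝ) ≤ t := ht
      linarith
  set Φ : ℝ → ℝ := fun x =>
    Real.exp (-(lam * x)) * (K * ((x + 1)⁻¹ * (x + 1)⁻¹) + (2 * K * lam ^ 2 * (x + 1) + 2 * K * lam))
    with hΦ
  have hΦ0 : ∀ x, 0 ≤ x → 0 ≤ Φ x := fun x hx => by positivity
  have hHb : ∀ x, 1 ≤ x → |expHead lam D x| ≤ Φ x := fun x hx => by
    have hcmp : ∀ y, x ≤ y → |expHead lam D y - expHead lam D x| ≤ Φ x := fun y hy => by
      have h := abs_sub_le_sub_of_abs_deriv_le (f := expHead lam D) (g := Φ) (a := 1)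
        (f' := fun z => lam * Real.exp (-(lam * z)) * D z)
        (g' := fun z => -(lam * Real.exp (-(lam * z))) *
          (K * ((z + 1)⁻¹ * (z + 1)⁻¹) + (2 * K * lam ^ 2 * (z + 1) + 2 * K * lam))
          + Real.exp (-(lam * z)) * (K * (-((z + 1) ^ 2)⁻¹ * (z + 1)⁻¹
            + (z + 1)⁻¹ * -((z + 1) ^ 2)⁻¹) + 2 * K * lam ^ 2 * 1))
        hHc.continuousOn
        (ContinuousOn.mul (by fun_prop)
          ((continuousOn_const.mul (hinvc.mul hinvc)).add (by fun_prop)))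
        (fun z hz => hasDerivAt_primitive_mul hw2 hDm hi (hDc z hz))
        (fun z hz => (hexpd z).mul ((((hinvd z hz).mul (hinvd z hz)).const_mul K).add
          (((hlin z).const_mul (2 * K * lam ^ 2)).add_const (2 * K * lam))))
        (fun z hz => ?_) hx hy
      · linarith [hΦ0 y (by linarith)]
      · have hz0 : 0 ≤ z := by linarith
        have he := Real.exp_pos (-(lam * z))
        have hbz := hb z hz0
        rw [abs_mul, abs_of_pos (by positivity : 0 < lam * Real.exp (-(lam * z)))]
        have h1 : lam * Real.exp (-(lam * z)) * |D z| ≤ lam * Real.exp (-(lam * z)) *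
            (K / (z + 1) ^ 2 + 2 * K * lam ^ 2 * (z + 1)) := by gcongr
        have h2 : 0 ≤ Real.exp (-(lam * z)) * (2 * K * ((z + 1)⁻¹ * ((z + 1) ^ 2)⁻¹)) := by
          positivity
        have h3 : (z + 1)⁻¹ * (z + 1)⁻¹ = ((z + 1) ^ 2)⁻¹ := by rw [← mul_inv, sq]
        rw [h3]
        rw [div_eq_mul_inv] at h1
        linarith
    have h1 : Tendsto (fun y => |expHead lam D y - expHead lam D x|) atTop
        (nhds |0 - expHead lam D x|) := (hHlim.sub_const _).abs
    rw [zero_sub, abs_neg] at h1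
    refine le_of_tendsto h1 ?_
    filter_upwards [eventually_ge_atTop x] with y hy using hcmp y hy
  set P : ℝ → ℝ := fun x => ∫ t in (0:ℝ)..x, D t with hP
  have hPc : Continuous P := intervalIntegral.continuous_primitive hi 0
  have hPd : ∀ x, 1 < x → HasDerivAt P (D x) x := fun x hx =>
    intervalIntegral.integral_hasDerivAt_right (hi 0 x)
      hDm.stronglyMeasurable.stronglyMeasurableAtFilter (hDc x hx)
  have hPsub : ∀ x, P (x + 1) - P x = ∫ t in x..(x + 1), D t := fun x =>
    intervalIntegral.integral_interval_sub_left (hi _ _) (hi _ _)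
  set V : ℝ → ℝ := fun x => expMean lam D x + lam * (P (x + 1) - P x) with hV
  have hVlim : Tendsto V atTop (nhds (δ + lam * δ)) := by
    refine hGlim.add (Tendsto.const_mul lam ?_)
    rw [Metric.tendsto_atTop]
    intro ε hε
    obtain ⟨X, hX⟩ := Metric.tendsto_atTop.1 hlim (ε / 2) (by linarith)
    refine ⟨X, fun x hx => ?_⟩
    have h1 : P (x + 1) - P x - δ = ∫ t in x..(x + 1), (D t - δ) := by
      rw [hPsub, intervalIntegral.integral_sub (hi _ _) (by simp)]
      simp
    rw [Real.dist_eq, h1, ← Real.norm_eq_abs]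
    refine (intervalIntegral.norm_integral_le_of_norm_le_const (C := ε / 2)
      fun t ht => ?_).trans_lt (by simp; linarith)
    rw [Set.uIoc_of_le (by linarith)] at ht
    have := hX t (hx.trans ht.1.le)
    rw [Real.dist_eq] at this
    exact this.le
  set Θ : ℝ → ℝ := fun x => 2 * K * lam * (x + 1)⁻¹ +
    Real.exp (-(lam * x)) * (4 * K * lam ^ 2 * (x + 1) + 8 * K * lam) with hΘ
  have hVb : ∀ y, 2 ≤ y → |V y - V 2| ≤ Θ 2 := fun y hy => by
    have h := abs_sub_le_sub_of_abs_deriv_le (f := V) (g := Θ) (a := 1)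
      (f' := fun z => (-(lam * Real.exp (-(lam * z))) *
          (∫ t in (0:ℝ)..z, lam * Real.exp (lam * t) * D t)
          + Real.exp (-(lam * z)) * (lam * Real.exp (lam * z) * D z))
          + lam * (D (z + 1) - D z))
      (g' := fun z => 2 * K * lam * -((z + 1) ^ 2)⁻¹ +
        (-(lam * Real.exp (-(lam * z))) * (4 * K * lam ^ 2 * (z + 1) + 8 * K * lam)
          + Real.exp (-(lam * z)) * (4 * K * lam ^ 2 * 1)))
      (hGc.add (continuous_const.mul
        ((hPc.comp (continuous_id.add continuous_const)).sub hPc))).continuousOn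
      ((continuousOn_const.mul hinvc).add (by fun_prop))
      (fun z hz => ((hexpd z).mul (hasDerivAt_primitive_mul hw1 hDm hi (hDc z hz))).add
        ((((hPd (z + 1) (by linarith)).comp_add_const z 1).sub (hPd z hz)).const_mul lam))
      (fun z hz => ((hinvd z hz).const_mul (2 * K * lam)).add
        ((hexpd z).mul (((hlin z).const_mul (4 * K * lam ^ 2)).add_const (8 * K * lam))))
      (fun z hz => ?_) one_le_two hy
    · have : 0 ≤ Θ y := by positivity
      linarith
    · have hz0 : 0 < z := by linarith
      have hpos := Real.exp_pos (-(lam * z))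
      have hle1 : Real.exp (-(lam * z)) ≤ 1 := Real.exp_le_one_iff.2 (by nlinarith)
      have he : Real.exp (-(lam * z)) * Real.exp (lam * z) = 1 := by rw [← Real.exp_add]; simp
      have hV' : (-(lam * Real.exp (-(lam * z))) *
          (∫ t in (0:ℝ)..z, lam * Real.exp (lam * t) * D t)
          + Real.exp (-(lam * z)) * (lam * Real.exp (lam * z) * D z))
          + lam * (D (z + 1) - D z)
          = lam * (expHead lam D z + Real.exp (-(lam * z)) * D (z + 1)) := by
        have h := heq z hz0
        rw [expMean] at h
        linear_combination lam * D z * he + lam * h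
      rw [hV', abs_mul, abs_of_pos hl]
      have hH := hHb z hz.le
      have hD1 := hb (z + 1) (by linarith)
      have hinv : K / (z + 1 + 1) ^ 2 ≤ K * ((z + 1) ^ 2)⁻¹ := by
        rw [div_eq_mul_inv]
        gcongr
        linarith
      have h3 : (z + 1)⁻¹ * (z + 1)⁻¹ = ((z + 1) ^ 2)⁻¹ := by rw [← mul_inv, sq]
      simp only [hΦ, h3] at hH
      have hq0 : 0 ≤ K * ((z + 1) ^ 2)⁻¹ := by positivity
      have hsq : K * lam ^ 2 ≤ K * lam := by gcongr; nlinarith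
      have hD2 : |D (z + 1)| ≤ K * ((z + 1) ^ 2)⁻¹ + (2 * K * lam ^ 2 * (z + 1) + 2 * K * lam) := by
        linarith
      have hsum : |expHead lam D z + Real.exp (-(lam * z)) * D (z + 1)|
          ≤ 2 * K * ((z + 1) ^ 2)⁻¹
            + Real.exp (-(lam * z)) * (4 * K * lam ^ 2 * (z + 1) + 4 * K * lam) := by
        refine (abs_add_le _ _).trans ?_
        rw [abs_mul, abs_of_pos hpos]
        have h4 := mul_le_mul_of_nonneg_left hD2 hpos.le
        have h5 : Real.exp (-(lam * z)) * (K * ((z + 1) ^ 2)⁻¹) ≤ K * ((z + 1) ^ 2)⁻¹ :=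
          mul_le_of_le_one_left hq0 hle1
        linarith
      refine (mul_le_mul_of_nonneg_left hsum hl.le).trans (le_of_eq ?_)
      ring
  have hD9 : ∀ t, 0 ≤ t → t ≤ 3 → |D t| ≤ 9 * K := fun t h0 h3 => by
    refine (hb t h0).trans ?_
    have h1 : K / (t + 1) ^ 2 ≤ K := div_le_self hK.le (one_le_pow₀ (by linarith))
    have h2 : lam ^ 2 ≤ 1 := pow_le_one₀ hl.le hl1
    have h4 : K * lam ^ 2 * (t + 1) ≤ K * 1 * 4 := by gcongr; linarith
    linarith
  have hV2 : |V 2| ≤ 27 * K * lam := by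
    have h1 : |expMean lam D 2| ≤ 18 * K * lam := by
      rw [expMean, ← intervalIntegral.integral_const_mul, ← Real.norm_eq_abs]
      refine (intervalIntegral.norm_integral_le_of_norm_le_const (C := 9 * K * lam)
        fun t ht => ?_).trans (le_of_eq (by norm_num; ring))
      rw [Set.uIoc_of_le (by norm_num)] at ht
      have h2 : Real.exp (-(lam * 2)) * Real.exp (lam * t) ≤ 1 := by
        rw [← Real.exp_add]
        exact Real.exp_le_one_iff.2 (by nlinarith [ht.2])
      have h3 := hD9 t ht.1.le (by linarith [ht.2])
      have h4 : Real.exp (-(lam * 2)) * (lam * Real.exp (lam * t) * D t)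
          = (Real.exp (-(lam * 2)) * Real.exp (lam * t)) * (lam * D t) := by ring
      rw [h4, norm_mul, norm_mul lam,
        Real.norm_of_nonneg (by positivity : 0 ≤ Real.exp (-(lam * 2)) * Real.exp (lam * t)),
        Real.norm_of_nonneg hl.le, Real.norm_eq_abs]
      calc _ ≤ 1 * (lam * (9 * K)) := by gcongr
        _ = _ := by ring
    have h5 : |P (2 + 1) - P 2| ≤ 9 * K := by
      rw [hPsub, ← Real.norm_eq_abs]
      refine (intervalIntegral.norm_integral_le_of_norm_le_const (C := 9 * K)
        fun t ht => ?_).trans (le_of_eq (by norm_num))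
      rw [Set.uIoc_of_le (by norm_num)] at ht
      exact hD9 t (by linarith [ht.1]) (by linarith [ht.2])
    refine (abs_add_le _ _).trans ?_
    rw [abs_mul, abs_of_pos hl]
    have := mul_le_mul_of_nonneg_left h5 hl.le
    linarith
  have hΘ2 : Θ 2 ≤ 21 * K * lam := by
    have hle1 : Real.exp (-(lam * 2)) ≤ 1 := Real.exp_le_one_iff.2 (by linarith)
    have h1 : Real.exp (-(lam * 2)) * (4 * K * lam ^ 2 * (2 + 1) + 8 * K * lam)
        ≤ 4 * K * lam ^ 2 * (2 + 1) + 8 * K * lam :=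
      mul_le_of_le_one_left (by positivity) hle1
    have hsq : K * lam ^ 2 ≤ K * lam := by gcongr; nlinarith
    have h2 : 0 < K * lam := by positivity
    simp only [hΘ]
    norm_num at h1 ⊢
    linarith
  have hVall : |δ + lam * δ| ≤ 48 * K * lam := by
    refine le_of_tendsto hVlim.abs ?_
    filter_upwards [eventually_ge_atTop 2] with y hy
    have h1 := hVb y hy
    have h2 := abs_sub_abs_le_abs_sub (V y) (V 2)
    linarith
  refine le_trans ?_ hVall
  rw [← one_add_mul, abs_mul, abs_of_pos (by linarith : 0 < 1 + lam)]
  nlinarith [abs_nonneg δ]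

theorem IsExpParkingSol.abs_sub_linear_le {lam : ℝ} {F : ℝ → ℝ} (hF : IsExpParkingSol lam F)
    (c x : ℝ) : |F x - c * (x + 1)| ≤ (1 + |c|) * (|x| + 1) := by
  have h1 := abs_sub (F x) (c * (x + 1))
  have h2 : |c * (x + 1)| ≤ |c| * (|x| + 1) := by
    rw [abs_mul]
    gcongr
    simpa using abs_add_le x 1
  linarith [hF.abs_le x]

theorem IsExpParkingSol.mul_sub_linear_eq {lam : ℝ} (hl : 0 < lam) {F : ℝ → ℝ}
    (hF : IsExpParkingSol lam F) (c : ℝ) {x : ℝ} (hx : 0 < x) :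
    (1 - Real.exp (-(lam * x))) * (F (x + 1) - c * (x + 1 + 1))
      = expHead lam (fun t => F t - c * (t + 1)) x + expMean lam (fun t => F t - c * (t + 1)) x := by
  have hk := continuous_expKernel lam x
  have h0 := one_sub_exp_neg_pos hl hx
  have hi : IntervalIntegrable F volume 0 x :=
    intervalIntegrable_of_linear_bound hF.measurable (A := 1) (by simpa using hF.abs_le) _ _
  have hiD : IntervalIntegrable (fun t => F t - c * (t + 1)) volume 0 x :=
    hi.sub (Continuous.intervalIntegrable (by fun_prop) _ _)
  have h1 : F (x + 1) - c * (x + 1 + 1)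
      = ∫ t in (0:ℝ)..x, expKernel lam x t * (F t - c * (t + 1)) := by
    have h2 : ∀ t, expKernel lam x t * (F t - c * (t + 1))
        = expKernel lam x t * F t - c * (expKernel lam x t * t + expKernel lam x t) := fun t => by
      ring
    simp only [h2]
    rw [intervalIntegral.integral_sub (hi.continuousOn_mul hk.continuousOn)
      (Continuous.intervalIntegrable (by fun_prop) _ _), intervalIntegral.integral_const_mul,
      intervalIntegral.integral_add (Continuous.intervalIntegrable (by fun_prop) _ _)
      (hk.intervalIntegrable _ _), integral_expKernel_mul_id hl hx, integral_expKernel hl hx,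
      ← hF.eq_integral x hx]
    ring
  rw [h1, expHead, expMean, ← intervalIntegral.integral_const_mul,
    ← intervalIntegral.integral_const_mul, ← intervalIntegral.integral_add
      (hiD.continuousOn_mul (Continuous.continuousOn (by fun_prop)))
      ((hiD.continuousOn_mul (Continuous.continuousOn (by fun_prop))).const_mul _)]
  congr 1
  funext t
  have h3 : Real.exp (-(lam * (x - t))) = Real.exp (-(lam * x)) * Real.exp (lam * t) := by
    rw [← Real.exp_add]; ring_nf
  rw [expKernel, h3]
  field_simp

/-- Quantitative comparison of the asymptotic constants with those of the uniform case. -/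
theorem exists_abs_constants_sub_le :
    ∃ K, 0 < K ∧ ∀ lam, 0 < lam → lam ≤ 1 → ∀ F : ℝ → ℝ, IsExpParkingSol lam F → ∀ c δ : ℝ,
      Tendsto (fun x => F x / x) atTop (nhds c) →
      Tendsto (fun x => F x - c * (x + 1)) atTop (nhds δ) →
      |c - renyiConst| ≤ K * lam ∧ |δ| ≤ K * lam := by
  obtain ⟨K, hK, hKb⟩ := exists_renyiError_bound
  refine ⟨96 * K, by positivity, fun lam hl hl1 F hF c δ hc hδ => ?_⟩
  have hcmp : ∀ x, 0 ≤ x → |F x - renyiConst * (x + 1)|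
      ≤ 2 * K * lam ^ 2 * x + K / (x + 1) ^ 4 := fun x hx => by
    have h1 := abs_sub_renyiFun_le hK hKb hl hF hx
    have h2 := hKb x hx
    rw [renyiError] at h2
    exact (abs_sub_le _ (renyiFun x) _).trans (add_le_add h1 h2)
  have hcb : |c - renyiConst| ≤ 2 * K * lam ^ 2 := by
    have hinv : Tendsto (fun x : ℝ => x⁻¹) atTop (nhds 0) := tendsto_inv_atTop_zero
    have h1 : Tendsto (fun x => |F x / x - renyiConst * (1 + x⁻¹)|) atTop
        (nhds |c - renyiConst * (1 + 0)|) :=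
      (hc.sub ((hinv.const_add 1).const_mul _)).abs
    have h2 : Tendsto (fun x : ℝ => 2 * K * lam ^ 2 + K * x⁻¹) atTop
        (nhds (2 * K * lam ^ 2 + K * 0)) := (hinv.const_mul K).const_add _
    rw [add_zero, mul_one] at h1
    rw [mul_zero, add_zero] at h2
    refine le_of_tendsto_of_tendsto h1 h2 ?_
    filter_upwards [eventually_gt_atTop 0] with x hx
    have h3 := hcmp x hx.le
    have h4 : K / (x + 1) ^ 4 ≤ K := div_le_self hK.le (one_le_pow₀ (by linarith))
    have h5 : F x / x - renyiConst * (1 + x⁻¹) = (F x - renyiConst * (x + 1)) * x⁻¹ := by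
      field_simp
    rw [h5, abs_mul, abs_of_pos (inv_pos.2 hx)]
    calc _ ≤ (2 * K * lam ^ 2 * x + K) * x⁻¹ := by gcongr; linarith
      _ = _ := by field_simp
  have hlam : lam ^ 2 ≤ lam := by nlinarith
  refine ⟨hcb.trans ?_, ?_⟩
  · have : K * lam ^ 2 ≤ K * lam := by gcongr
    have : 0 < K * lam := by positivity
    linarith
  have hDm : Measurable fun x => F x - c * (x + 1) := hF.measurable.sub (by fun_prop)
  have := abs_limit_le hl hl1 (by positivity : 0 < 2 * K) hDm
    (intervalIntegrable_of_linear_bound hDm (hF.abs_sub_linear_le c))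
    (fun x hx => hF.mul_sub_linear_eq hl c hx) hδ fun x hx => by
      have h1 : F x - c * (x + 1)
          = (F x - renyiConst * (x + 1)) - (c - renyiConst) * (x + 1) := by ring
      have h2 : |(c - renyiConst) * (x + 1)| ≤ 2 * K * lam ^ 2 * (x + 1) := by
        rw [abs_mul, abs_of_pos (by linarith : 0 < x + 1)]
        gcongr
      have h3 := hcmp x hx
      have h4 : K / (x + 1) ^ 4 ≤ K / (x + 1) ^ 2 := by
        gcongr
        · linarith
        · norm_num
      have h5 : 0 ≤ K / (x + 1) ^ 2 := by positivity
      have h6 : 0 ≤ K * lam ^ 2 := by positivity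
      rw [h1]
      refine (abs_sub _ _).trans ?_
      rw [mul_div_assoc]
      linarith
  linarith

/-- **Section 5 of the paper (convergence to the uniform case).** As `λ → 0⁺`,
the asymptotic constants `C_λ` and `B_λ` of the exponential parking problem
converge to Rényi's constants `C` and `B = -(1 - C)`, where
`C = ∫₀^∞ exp (-2 ∫₀ᵗ (1 - e^{-u})/u du) dt`. -/
theorem expParking_constants_tendsto_renyi
    (C : ℝ)
    (hC : C = ∫ t in Set.Ioi (0:ℝ),
      Real.exp (-2 * ∫ u in (0:ℝ)..t, (1 - Real.exp (-u)) / u))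
    (Mf : ℝ → ℝ → ℝ) (Cl Bl : ℝ → ℝ)
    (hMf : ∀ lam : ℝ, 0 < lam →
      Measurable (Mf lam) ∧ MonotoneOn (Mf lam) (Set.Ici 0) ∧
      (∀ x : ℝ, 0 ≤ x → 0 ≤ Mf lam x ∧ Mf lam x ≤ x) ∧
      SatisfiesExpParkingEq lam (Mf lam))
    (hCl : ∀ lam : ℝ, 0 < lam →
      Tendsto (fun x : ℝ => Mf lam x / x) atTop (nhds (Cl lam)))
    (hBl : ∀ lam : ℝ, 0 < lam →
      Tendsto (fun x : ℝ => Mf lam x - Cl lam * x) atTop (nhds (Bl lam))) :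
    Tendsto Cl (nhdsWithin 0 (Set.Ioi 0)) (nhds C) ∧
    Tendsto Bl (nhdsWithin 0 (Set.Ioi 0)) (nhds (-(1 - C))) := by
  obtain ⟨K, hK, hKb⟩ := exists_abs_constants_sub_le
  have hCr : C = renyiConst := hC
  have hbound : ∀ lam, 0 < lam → lam ≤ 1 →
      |Cl lam - C| ≤ K * lam ∧ |Bl lam + 1 - Cl lam| ≤ K * lam := fun lam hl hl1 => by
    obtain ⟨hm, -, hb, hM⟩ := hMf lam hl
    rw [hCr]
    refine hKb lam hl hl1 _ (isExpParkingSol_of_satisfies hl hm hb hM) _ _ ?_ ?_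
    · have h1 := (hCl lam hl).add tendsto_inv_atTop_zero
      rw [add_zero] at h1
      refine h1.congr' ?_
      filter_upwards [eventually_ge_atTop 0] with x hx
      rw [if_pos hx, add_div, one_div]
    · refine (((hBl lam hl).add_const 1).sub_const (Cl lam)).congr' ?_
      filter_upwards [eventually_ge_atTop 0] with x hx
      rw [if_pos hx]
      ring
  have hsmall : ∀ᶠ lam : ℝ in nhdsWithin 0 (Set.Ioi 0), 0 < lam ∧ lam ≤ 1 := by
    filter_upwards [Ioc_mem_nhdsGT (zero_lt_one' ℝ)] with lam h using h
  have hlim : Tendsto (fun lam : ℝ => K * lam) (nhdsWithin 0 (Set.Ioi 0)) (nhds 0) := by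
    have h : Tendsto (fun lam : ℝ => K * lam) (nhds 0) (nhds (K * 0)) :=
      Continuous.tendsto (by fun_prop) 0
    rw [mul_zero] at h
    exact h.mono_left nhdsWithin_le_nhds
  have h1 : Tendsto (fun lam => Cl lam - C) (nhdsWithin 0 (Set.Ioi 0)) (nhds 0) :=
    squeeze_zero_norm' (hsmall.mono fun lam h => (hbound lam h.1 h.2).1) hlim
  have h2 : Tendsto (fun lam => Bl lam + 1 - Cl lam) (nhdsWithin 0 (Set.Ioi 0)) (nhds 0) :=
    squeeze_zero_norm' (hsmall.mono fun lam h => (hbound lam h.1 h.2).2) hlim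
  constructor
  · simpa using h1.add_const C
  · have h3 := (h2.add h1).add_const (-(1 - C))
    rw [zero_add, zero_add] at h3
    refine h3.congr fun lam => ?_
    ring
end

section
/- Let λ > 0 and let M : ℝ → ℝ be measurable with ⌈(x−1)/2⌉ ≤ M(x) ≤ ⌊x⌋ for all x > 0. Then, writing φ(λ) = ∫₀^∞ M(x) e^{−λx} dx, one has (λ/(λ+1)) · (1 + e^{−λ}/(1 − e^{−2λ})) ≤ (λ/(λ+1)) · (1 + λ φ(λ)) ≤ (λ/(λ+1)) · (1 + e^{−λ}/(1 − e^{−λ})). In particular this rests on the identities ∫₀^∞ λ ⌊x⌋ e^{−λx} dx = e^{−λ}/(1 − e^{−λ}) and ∫₀^∞ λ ⌈(x−1)/2⌉ e^{−λx} dx = e^{−λ}/(1 − e^{−2λ}). -/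
open MeasureTheory Filter

/-- The Laplace transform of an arithmetic-progression counting function. -/
theorem integral_ceil_sub_div_mul_exp {lam b c : ℝ} (hlam : 0 < lam) (hb : 0 ≤ b) (hc : 0 < c)
    (hbc : b ≤ c) :
    ∫ x in Set.Ioi (0 : ℝ), lam * (⌈(x - b) / c⌉ : ℝ) * Real.exp (-lam * x)
      = Real.exp (-lam * b) / (1 - Real.exp (-lam * c)) := by
  let g : ℝ → ℝ := fun x => lam * Real.exp (-lam * x)
  let F : ℕ → ℝ → ℝ := fun n => (Set.Ioi (b + c * n)).indicator g
  have hg : IntegrableOn g (Set.Ioi 0) :=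
    (integrableOn_exp_mul_Ioi (neg_lt_zero.mpr hlam) 0).const_mul lam
  have hF (n : ℕ) : Integrable (F n) (volume.restrict (Set.Ioi 0)) :=
    hg.indicator measurableSet_Ioi
  have hnonneg (n : ℕ) (x : ℝ) : 0 ≤ F n x :=
    Set.indicator_nonneg (fun y _ => by positivity) x
  have hint (n : ℕ) : ∫ x in Set.Ioi (0 : ℝ), F n x
      = Real.exp (-lam * b) * Real.exp (-lam * c) ^ n := by
    have hpos : 0 ≤ b + c * n := by positivity
    rw [setIntegral_indicator measurableSet_Ioi,
      Set.inter_eq_self_of_subset_right (Set.Ioi_subset_Ioi hpos), integral_const_mul,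
      integral_exp_mul_Ioi (neg_lt_zero.mpr hlam), ← Real.exp_nat_mul, ← Real.exp_add]
    field_simp
    ring_nf
  have hgeom : HasSum (fun n : ℕ => Real.exp (-lam * b) * Real.exp (-lam * c) ^ n)
      (Real.exp (-lam * b) / (1 - Real.exp (-lam * c))) := by
    rw [div_eq_mul_inv]
    refine (hasSum_geometric_of_lt_one (Real.exp_nonneg _) ?_).mul_left _
    rw [Real.exp_lt_one_iff]
    nlinarith
  have hsum := hasSum_integral_of_summable_integral_norm hF <| by
    simpa only [Real.norm_of_nonneg (hnonneg _ _), hint] using hgeom.summable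
  simp only [hint] at hsum
  rw [← hsum.unique hgeom]
  refine setIntegral_congr_fun measurableSet_Ioi fun x hx => ?_
  have hx : 0 < x := hx
  have hlt : -1 < (x - b) / c := by
    rw [lt_div_iff₀ hc]
    linarith
  have hmem (n : ℕ) : x ∈ Set.Ioi (b + c * n) ↔ n ∈ Finset.range ⌈(x - b) / c⌉₊ := by
    rw [Finset.mem_range, Nat.lt_ceil, lt_div_iff₀ hc, Set.mem_Ioi]
    constructor <;> intro h <;> linarith
  rw [tsum_eq_sum (s := Finset.range ⌈(x - b) / c⌉₊) fun n hn =>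
      Set.indicator_of_notMem (mt (hmem n).mp hn) _,
    Finset.sum_congr rfl fun n hn => Set.indicator_of_mem ((hmem n).mpr hn) g,
    Finset.sum_const, Finset.card_range, nsmul_eq_mul,
    ← Int.natCast_ceil_eq_ceil_of_neg_one_lt hlt]
  simp only [g, Int.cast_natCast]
  ring

/-- The floor agrees almost everywhere with the shifted ceiling. -/
theorem floor_ae_eq_ceil_sub_one : ∀ᵐ x : ℝ, ⌊x⌋ = ⌈x - 1⌉ := by
  filter_upwards [(Set.countable_range ((↑) : ℤ → ℝ)).ae_notMem volume] with x hx
  rw [eq_comm, Int.ceil_eq_iff]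
  have h := Int.lt_floor_add_one x
  have h' : (⌊x⌋ : ℝ) < x := (Int.floor_le x).lt_of_ne fun h => hx ⟨_, h⟩
  constructor <;> linarith

/-- **Estimate (15) of the paper.** If `⌈(x-1)/2⌉ ≤ M x ≤ ⌊x⌋` for all `x > 0`,
then with `φ(λ) = ∫₀^∞ M x e^{-λ x} dx` one has
`(λ/(λ+1))(1 + e^{-λ}/(1 - e^{-2λ})) ≤ (λ/(λ+1))(1 + λ φ(λ)) ≤
 (λ/(λ+1))(1 + e^{-λ}/(1 - e^{-λ}))`, together with the two underlying
Laplace-integral identities for the floor and ceiling functions. -/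
theorem expParking_slope_bounds
    (lam : ℝ) (hlam : 0 < lam) (M : ℝ → ℝ)
    (hmeas : Measurable M)
    (hbound : ∀ x : ℝ, 0 < x → (⌈(x - 1) / 2⌉ : ℝ) ≤ M x ∧ M x ≤ (⌊x⌋ : ℝ)) :
    ((lam / (lam + 1)) * (1 + Real.exp (-lam) / (1 - Real.exp (-2 * lam)))
      ≤ (lam / (lam + 1)) *
        (1 + lam * ∫ x in Set.Ioi (0:ℝ), M x * Real.exp (-lam * x)) ∧
     (lam / (lam + 1)) *
        (1 + lam * ∫ x in Set.Ioi (0:ℝ), M x * Real.exp (-lam * x))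
      ≤ (lam / (lam + 1)) * (1 + Real.exp (-lam) / (1 - Real.exp (-lam)))) ∧
    (∫ x in Set.Ioi (0:ℝ), lam * (⌊x⌋ : ℝ) * Real.exp (-lam * x)
      = Real.exp (-lam) / (1 - Real.exp (-lam))) ∧
    (∫ x in Set.Ioi (0:ℝ), lam * (⌈(x - 1) / 2⌉ : ℝ) * Real.exp (-lam * x)
      = Real.exp (-lam) / (1 - Real.exp (-2 * lam))) := by
  have hfloor : ∫ x in Set.Ioi (0:ℝ), lam * (⌊x⌋ : ℝ) * Real.exp (-lam * x)
      = Real.exp (-lam) / (1 - Real.exp (-lam)) := by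
    have h := integral_ceil_sub_div_mul_exp hlam zero_le_one one_pos le_rfl
    simp only [mul_one, div_one] at h
    rw [← h]
    refine integral_congr_ae (ae_restrict_of_ae ?_)
    filter_upwards [floor_ae_eq_ceil_sub_one] with x hx
    rw [hx]
  have hceil : ∫ x in Set.Ioi (0:ℝ), lam * (⌈(x - 1) / 2⌉ : ℝ) * Real.exp (-lam * x)
      = Real.exp (-lam) / (1 - Real.exp (-2 * lam)) := by
    have h := integral_ceil_sub_div_mul_exp hlam zero_le_one two_pos one_le_two
    rw [h]
    ring_nf
  have hnonneg (x : ℝ) (hx : 0 < x) : (0 : ℝ) ≤ ⌈(x - 1) / 2⌉ := by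
    have h : -1 < (x - 1) / 2 := by linarith
    exact_mod_cast Int.ceil_nonneg_of_neg_one_lt h
  have hdom : IntegrableOn (fun x : ℝ => x * Real.exp (-lam * x)) (Set.Ioi 0) := by
    simpa using integrableOn_rpow_mul_exp_neg_mul_rpow (p := 1) (s := 1) (by norm_num)
      one_pos hlam
  have hint (f : ℝ → ℝ) (hf : Measurable f) (h : ∀ x, 0 < x → 0 ≤ f x ∧ f x ≤ ⌊x⌋) :
      IntegrableOn (fun x => lam * f x * Real.exp (-lam * x)) (Set.Ioi 0) := by
    refine (hdom.const_mul lam).mono' (by fun_prop) ?_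
    filter_upwards [ae_restrict_mem measurableSet_Ioi] with x hx
    obtain ⟨h₀, h₁⟩ := h x hx
    rw [Real.norm_of_nonneg (by positivity), mul_assoc]
    gcongr
    exact h₁.trans (Int.floor_le x)
  have hM : lam * ∫ x in Set.Ioi (0:ℝ), M x * Real.exp (-lam * x)
      = ∫ x in Set.Ioi (0:ℝ), lam * M x * Real.exp (-lam * x) := by
    rw [← integral_const_mul]
    simp only [mul_assoc]
  have hMint := hint M hmeas fun x hx => ⟨(hnonneg x hx).trans (hbound x hx).1, (hbound x hx).2⟩
  have hfloorInt := hint (fun x => ⌊x⌋) (by fun_prop) fun x hx =>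
    ⟨(hnonneg x hx).trans ((hbound x hx).1.trans (hbound x hx).2), le_rfl⟩
  have hceilInt := hint (fun x => ⌈(x - 1) / 2⌉) (by fun_prop) fun x hx =>
    ⟨hnonneg x hx, (hbound x hx).1.trans (hbound x hx).2⟩
  refine ⟨⟨?_, ?_⟩, hfloor, hceil⟩
  · rw [hM, ← hceil]
    gcongr ?_ * (1 + ?_)
    refine setIntegral_mono_on hceilInt hMint measurableSet_Ioi fun x hx => ?_
    gcongr
    exact (hbound x hx).1
  · rw [hM, ← hfloor]
    gcongr ?_ * (1 + ?_)
    refine setIntegral_mono_on hMint hfloorInt measurableSet_Ioi fun x hx => ?_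
    gcongr
    exact (hbound x hx).2
end

section
/- Let λ > 0 and let M : ℝ → ℝ be measurable and nondecreasing with 0 ≤ M(x) ≤ x for all x ≥ 0, satisfying the exponential parking equation with rate λ, and let C_λ = lim_{x→∞} M(x)/x. Then the limit B_λ := lim_{x→∞} (M(x) − C_λ x) exists and equals B_λ = −λ(λ+2)(1 + λφ(λ)) / (2(λ+1)²) + (λ/(λ+1)) · ((1 + e^{λ}) φ(λ) + λ φ′(λ)), where φ(λ) = ∫₀^∞ M(x) e^{−λx} dx and φ′(λ) = −∫₀^∞ x M(x) e^{−λx} dx. -/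
open MeasureTheory Filter

open Set in
/-- One step of a linear delay equation: a function satisfying `n' ≤ a (c - n)` on a unit
interval approaches the ceiling `c` no faster than exponentially. -/
lemma le_of_delay_hasDerivAt {a : ℝ} (ha : 0 < a) {n n' : ℝ → ℝ} {x c : ℝ}
    (hn : ContinuousOn n (Icc x (x + 1)))
    (hd : ∀ t ∈ Ioo x (x + 1), HasDerivAt n (n' t) t)
    (hle : ∀ t ∈ Ioo x (x + 1), n' t ≤ a * (c - n t)) (hc : n x ≤ c) :
    ∀ t ∈ Icc x (x + 1), n t ≤ c - Real.exp (-a) * (c - n x) := by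
  intro t ht
  have hderiv : ∀ s ∈ Ioo x (x + 1), HasDerivAt (fun s => Real.exp (a * s) * (n s - c))
      (Real.exp (a * s) * (a * 1) * (n s - c) + Real.exp (a * s) * n' s) s := fun s hs =>
    (((hasDerivAt_id s).const_mul a).exp).mul ((hd s hs).sub_const c)
  have hanti : AntitoneOn (fun s => Real.exp (a * s) * (n s - c)) (Icc x (x + 1)) := by
    apply antitoneOn_of_deriv_nonpos (convex_Icc _ _)
    · exact ContinuousOn.mul (by fun_prop) (hn.sub continuousOn_const)
    · rw [interior_Icc]
      exact fun s hs => (hderiv s hs).differentiableAt.differentiableWithinAt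
    · rw [interior_Icc]
      intro s hs
      rw [(hderiv s hs).deriv]
      have h1 := mul_le_mul_of_nonneg_left (hle s hs) (Real.exp_pos (a * s)).le
      nlinarith
  have h := hanti (left_mem_Icc.2 (by linarith)) ht ht.1
  simp only at h
  have hexp : Real.exp (a * x) = Real.exp (a * t) * Real.exp (-(a * (t - x))) := by
    rw [← Real.exp_add]; ring_nf
  rw [hexp, mul_assoc, mul_le_mul_iff_right₀ (Real.exp_pos _)] at h
  have h2 : Real.exp (-a) ≤ Real.exp (-(a * (t - x))) := by
    apply Real.exp_le_exp.2
    nlinarith [ht.2]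
  nlinarith

open Set in
/-- The oscillation over unit windows of a solution of a forced linear delay equation contracts. -/
lemma delay_window_step {a : ℝ} (ha : 0 < a) {n e : ℝ → ℝ} {x l w δ : ℝ}
    (hn : Continuous n)
    (hd : ∀ t, x < t → HasDerivAt n (a * (n (t - 1) - n t + e t)) t)
    (he : ∀ t, x < t → |e t| ≤ δ)
    (hδ : 0 ≤ δ)
    (hw : ∀ t ∈ Icc (x - 1) x, l ≤ n t ∧ n t ≤ l + w) :
    ∃ l', ∀ t ∈ Icc (x + 1 - 1) (x + 1),
      l' ≤ n t ∧ n t ≤ l' + (1 - Real.exp (-a)) * (w + 2 * δ) := by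
  have hx := hw x (right_mem_Icc.2 (by linarith))
  have hup := le_of_delay_hasDerivAt ha (c := l + w + δ) hn.continuousOn
    (fun t ht => hd t ht.1) (fun t ht => by
      have h1 := hw (t - 1) ⟨by linarith [ht.1], by linarith [ht.2]⟩
      have h2 := abs_le.1 (he t ht.1)
      exact mul_le_mul_of_nonneg_left (by linarith) ha.le) (by linarith)
  have hlo := le_of_delay_hasDerivAt ha (n := fun t => -n t) (c := -(l - δ)) hn.neg.continuousOn
    (fun t ht => (hd t ht.1).neg) (fun t ht => by
      have h1 := hw (t - 1) ⟨by linarith [ht.1], by linarith [ht.2]⟩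
      have h2 := abs_le.1 (he t ht.1)
      rw [← mul_neg]
      exact mul_le_mul_of_nonneg_left (by linarith) ha.le) (by linarith)
  refine ⟨l - δ + Real.exp (-a) * (n x - (l - δ)), fun t ht => ?_⟩
  rw [add_sub_cancel_right] at ht
  constructor
  · linarith [hlo t ht]
  · linarith [hup t ht]

open Set in
/-- Solutions of a linear delay equation with vanishing forcing have vanishing oscillation over
unit windows. -/
lemma eventually_delay_osc_le {a : ℝ} (ha : 0 < a) {n e : ℝ → ℝ} {x₀ : ℝ}
    (hn : Continuous n)
    (hd : ∀ t, x₀ < t → HasDerivAt n (a * (n (t - 1) - n t + e t)) t)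
    (he : Tendsto e atTop (nhds 0)) {η : ℝ} (hη : 0 < η) :
    ∀ᶠ x in atTop, ∀ t ∈ Icc (x - 1) x, |n t - n x| ≤ η := by
  set q := 1 - Real.exp (-a) with hq
  have hq1 : q < 1 := by linarith [Real.exp_pos (-a)]
  have hq0 : 0 ≤ q := by
    have : Real.exp (-a) < 1 := by simpa using ha
    linarith
  set δ := η * (1 - q) / 4 with hδ
  have hδ0 : 0 < δ := by
    have : 0 < 1 - q := by linarith
    positivity
  obtain ⟨X₁, hX₁⟩ := eventually_atTop.1 ((Metric.tendsto_nhds.1 he) δ hδ0)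
  set X := max X₁ x₀
  have he' : ∀ t, X ≤ t → |e t| ≤ δ := fun t ht => by
    have := hX₁ t (le_trans (le_max_left _ _) ht)
    rw [Real.dist_eq, sub_zero] at this
    exact this.le
  obtain ⟨B, hB⟩ := isCompact_Icc.exists_bound_of_continuousOn
    (hn.continuousOn (s := Icc (X - 1) (X + 1)))
  have key : ∀ j : ℕ, ∀ y ∈ Icc X (X + 1), ∃ l, ∀ t ∈ Icc (y + j - 1) (y + j),
      l ≤ n t ∧ n t ≤ l + (q ^ j * (2 * B) + η / 2) := by
    intro j
    induction j with
    | zero =>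
      intro y hy
      refine ⟨-B, fun t ht => ?_⟩
      simp only [Nat.cast_zero, add_zero] at ht
      have := abs_le.1 (hB t ⟨by linarith [ht.1, hy.1], by linarith [ht.2, hy.2]⟩)
      constructor
      · exact this.1
      · rw [pow_zero]; linarith [this.2]
    | succ j ih =>
      intro y hy
      obtain ⟨l, hl⟩ := ih y hy
      have hyj : X ≤ y + j := le_trans hy.1 (by simp)
      obtain ⟨l', hl'⟩ := delay_window_step ha (e := e) hn
        (fun t ht => hd t (lt_of_le_of_lt ((le_max_right _ _).trans hyj) ht))
        (fun t ht => he' t (hyj.trans ht.le)) hδ0.le hl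
      refine ⟨l', fun t ht => ?_⟩
      push_cast at ht
      rw [← add_assoc] at ht
      obtain ⟨h1, h2⟩ := hl' t ht
      refine ⟨h1, h2.trans ?_⟩
      rw [← hq, pow_succ, hδ]
      nlinarith [mul_nonneg hη.le (sq_nonneg (1 - q))]
  have hpow : Tendsto (fun j : ℕ => q ^ j * (2 * B) + η / 2) atTop (nhds (0 * (2 * B) + η / 2)) :=
    ((tendsto_pow_atTop_nhds_zero_of_lt_one hq0 hq1).mul_const _).add_const _
  obtain ⟨J, hJ⟩ := eventually_atTop.1 (hpow.eventually_le_const (u := η) (by linarith))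
  filter_upwards [eventually_ge_atTop (X + J)] with x hx
  have hx0 : 0 ≤ x - X := by linarith [(Nat.cast_nonneg J : (0:ℝ) ≤ J)]
  obtain ⟨l, hl⟩ := key ⌊x - X⌋₊ (x - ⌊x - X⌋₊)
    ⟨by linarith [Nat.floor_le hx0], by linarith [Nat.lt_floor_add_one (x - X)]⟩
  rw [sub_add_cancel] at hl
  have hJ' := hJ ⌊x - X⌋₊ (Nat.le_floor (by linarith))
  intro t ht
  have h1 := hl t ht
  have h2 := hl x (right_mem_Icc.2 (by linarith))
  exact abs_le.2 ⟨by linarith, by linarith⟩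

open Set in
/-- A function whose oscillation over unit windows vanishes at infinity and whose combination
with its window average converges is itself convergent. -/
lemma tendsto_of_window_average {a v : ℝ} (ha : 0 < a) {n : ℝ → ℝ} (hn : Continuous n)
    (hosc : ∀ η > 0, ∀ᶠ x in atTop, ∀ t ∈ Icc (x - 1) x, |n t - n x| ≤ η)
    (hv : Tendsto (fun x => n x + a * ∫ t in (x - 1)..x, n t) atTop (nhds v)) :
    Tendsto n atTop (nhds (v / (1 + a))) := by
  have h0 : Tendsto (fun x => ∫ t in (x - 1)..x, (n t - n x)) atTop (nhds 0) := by
    rw [Metric.tendsto_nhds]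
    intro η hη
    filter_upwards [hosc (η / 2) (by linarith)] with x hx
    rw [dist_zero_right]
    have := intervalIntegral.norm_integral_le_of_norm_le_const (a := x - 1) (b := x)
      (f := fun t => n t - n x) (C := η / 2) (fun t ht => by
        rw [uIoc_of_le (by linarith)] at ht
        exact hx t ⟨ht.1.le, ht.2⟩)
    rw [sub_sub_cancel, abs_one, mul_one] at this
    linarith
  have h1 := (hv.sub (h0.const_mul a)).div_const (1 + a)
  rw [mul_zero, sub_zero] at h1
  refine h1.congr fun x => ?_
  rw [intervalIntegral.integral_sub (hn.intervalIntegrable _ _) (by simp),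
    intervalIntegral.integral_const]
  simp only [sub_sub_cancel, one_smul]
  field_simp
  ring

/-- The truncated Laplace transform `∫₀ˣ M t e^{-λt} dt`. -/
noncomputable def truncLaplace (lam : ℝ) (M : ℝ → ℝ) (x : ℝ) : ℝ :=
  ∫ t in (0:ℝ)..x, M t * Real.exp (-lam * t)

/-- The exponential average `λ e^{-λx} ∫₀ˣ M t e^{λt} dt`, that is
`∫₀ˣ λ e^{-λt} M (x - t) dt`. -/
noncomputable def expAverage (lam : ℝ) (M : ℝ → ℝ) (x : ℝ) : ℝ :=
  lam * Real.exp (-lam * x) * ∫ t in (0:ℝ)..x, M t * Real.exp (lam * t)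

lemma Monotone.intervalIntegrable_mul_continuous {M g : ℝ → ℝ} (hM : Monotone M)
    (hg : Continuous g) (a b : ℝ) :
    IntervalIntegrable (fun t => M t * g t) volume a b :=
  hM.intervalIntegrable.mul_continuousOn hg.continuousOn

lemma continuous_truncLaplace {M : ℝ → ℝ} (hM : Monotone M) (lam : ℝ) :
    Continuous (truncLaplace lam M) :=
  intervalIntegral.continuous_primitive
    (hM.intervalIntegrable_mul_continuous (by fun_prop)) 0

lemma continuous_expAverage {M : ℝ → ℝ} (hM : Monotone M) (lam : ℝ) :
    Continuous (expAverage lam M) :=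
  Continuous.mul (by fun_prop) (intervalIntegral.continuous_primitive
    (hM.intervalIntegrable_mul_continuous (by fun_prop)) 0)

lemma Monotone.hasDerivAt_integral_mul {M g : ℝ → ℝ} (hM : Monotone M) (hg : Continuous g)
    {x : ℝ} (hx : ContinuousAt M x) :
    HasDerivAt (fun x => ∫ t in (0:ℝ)..x, M t * g t) (M x * g x) x :=
  intervalIntegral.integral_hasDerivAt_right (hM.intervalIntegrable_mul_continuous hg _ _)
    (hM.measurable.mul hg.measurable).stronglyMeasurable.stronglyMeasurableAtFilter
    (hx.mul hg.continuousAt)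

lemma hasDerivAt_expAverage {M : ℝ → ℝ} (hM : Monotone M) (lam : ℝ) {x : ℝ}
    (hx : ContinuousAt M x) :
    HasDerivAt (expAverage lam M) (lam * (M x - expAverage lam M x)) x := by
  have h1 : HasDerivAt (fun x => lam * Real.exp (-lam * x))
      (lam * (Real.exp (-lam * x) * (-lam * 1))) x :=
    (((hasDerivAt_id x).const_mul (-lam)).exp).const_mul lam
  have h2 := h1.mul (hM.hasDerivAt_integral_mul (g := fun t => Real.exp (lam * t))
    (by fun_prop) hx)
  refine h2.congr_deriv ?_
  have h3 : Real.exp (-lam * x) * Real.exp (lam * x) = 1 := by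
    rw [← Real.exp_add]; simp
  simp only [expAverage]
  linear_combination (lam * M x) * h3

lemma SatisfiesExpParkingEq.mul_one_sub_exp {lam : ℝ} (hlam : 0 < lam) {M : ℝ → ℝ}
    (hmono : Monotone M) (hM : SatisfiesExpParkingEq lam M) {x : ℝ} (hx : 0 < x) :
    M (x + 1) * (1 - Real.exp (-lam * x)) =
      lam * truncLaplace lam M x + expAverage lam M x + 1 - Real.exp (-lam * x) := by
  have hne : 1 - Real.exp (-lam * x) ≠ 0 := by
    have : Real.exp (-lam * x) < 1 := by
      rw [Real.exp_lt_one_iff]; nlinarith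
    linarith
  have hrefl : expAverage lam M x =
      ∫ t in (0:ℝ)..x, lam * Real.exp (-lam * t) * M (x - t) := by
    have h := intervalIntegral.integral_comp_sub_left (a := 0) (b := x)
      (fun t => lam * Real.exp (-lam * x) * (M t * Real.exp (lam * t))) x
    rw [sub_self, sub_zero] at h
    rw [expAverage, ← intervalIntegral.integral_const_mul, ← h]
    refine intervalIntegral.integral_congr fun t _ => ?_
    have h3 : Real.exp (-lam * t) = Real.exp (-lam * x) * Real.exp (lam * (x - t)) := by
      rw [← Real.exp_add]; ring_nf
    simp only [h3]
    ring
  have hint : IntervalIntegrable (fun t => lam * Real.exp (-lam * t) * M (x - t)) volume 0 x := by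
    have hanti : Antitone fun t => M (x - t) := fun s t hst => hmono (by linarith)
    exact hanti.intervalIntegrable.continuousOn_mul (by fun_prop)
  have hint' : IntervalIntegrable (fun t => lam * (M t * Real.exp (-lam * t))) volume 0 x :=
    (hmono.intervalIntegrable_mul_continuous (by fun_prop) _ _).const_mul lam
  have hsum : (∫ t in (0:ℝ)..x,
      (lam * Real.exp (-lam * t) / (1 - Real.exp (-lam * x))) * (M t + M (x - t))) =
      (lam * truncLaplace lam M x + expAverage lam M x) / (1 - Real.exp (-lam * x)) := by
    rw [hrefl, truncLaplace, ← intervalIntegral.integral_const_mul,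
      ← intervalIntegral.integral_add hint' hint, ← intervalIntegral.integral_div]
    refine intervalIntegral.integral_congr fun t _ => ?_
    ring
  rw [hM.2 x hx, hsum]
  rw [add_mul, div_mul_cancel₀ _ hne]
  ring

lemma SatisfiesExpParkingEq.continuousAt {lam : ℝ} (hlam : 0 < lam) {M : ℝ → ℝ}
    (hmono : Monotone M) (hM : SatisfiesExpParkingEq lam M) {x : ℝ} (hx : 1 < x) :
    ContinuousAt M x := by
  have hlt : ∀ y, 1 < y → Real.exp (-lam * (y - 1)) < 1 := fun y hy => by
    rw [Real.exp_lt_one_iff]; nlinarith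
  have hA := continuous_truncLaplace hmono lam
  have hN := continuous_expAverage hmono lam
  have hc : ContinuousAt (fun y => (lam * truncLaplace lam M (y - 1) + expAverage lam M (y - 1)
      + 1 - Real.exp (-lam * (y - 1))) / (1 - Real.exp (-lam * (y - 1)))) x :=
    ContinuousAt.div (by fun_prop) (by fun_prop) (by linarith [hlt x hx])
  refine hc.congr ?_
  filter_upwards [eventually_gt_nhds hx] with y hy
  rw [div_eq_iff (by linarith [hlt y hy]), ← hM.mul_one_sub_exp hlam hmono (by linarith),
    sub_add_cancel]

/-- For a monotone `M` vanishing on `(-∞, 1]`, an identity of derivatives away from `1`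
integrates. -/
lemma SatisfiesExpParkingEq.integral_eq_sub {lam : ℝ} (hlam : 0 < lam) {M : ℝ → ℝ}
    (hmono : Monotone M) (hM : SatisfiesExpParkingEq lam M) (h0 : ∀ x ≤ 1, M x = 0)
    {f f' : ℝ → ℝ} (hf : Continuous f)
    (hd : ∀ x, ContinuousAt M x → HasDerivAt f (f' x) x)
    (hi : ∀ a b, IntervalIntegrable f' volume a b) (x : ℝ) :
    ∫ t in (0:ℝ)..x, f' t = f x - f 0 := by
  refine integral_eq_of_hasDerivAt_off_countable f f' (Set.countable_singleton (1:ℝ))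
    hf.continuousOn (fun t ht => hd t ?_) (hi _ _)
  rcases lt_or_gt_of_ne (show t ≠ 1 from ht.2) with h | h
  · refine (continuousAt_const (y := (0:ℝ))).congr ?_
    filter_upwards [eventually_lt_nhds h] with y hy
    exact (h0 y hy.le).symm
  · exact hM.continuousAt hlam hmono h

lemma SatisfiesExpParkingEq.integral_truncLaplace {lam : ℝ} (hlam : 0 < lam) {M : ℝ → ℝ}
    (hmono : Monotone M) (hM : SatisfiesExpParkingEq lam M) (h0 : ∀ x ≤ 1, M x = 0) (x : ℝ) :
    ∫ t in (0:ℝ)..x, truncLaplace lam M t =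
      x * truncLaplace lam M x - ∫ t in (0:ℝ)..x, t * M t * Real.exp (-lam * t) := by
  have hA := continuous_truncLaplace hmono lam
  have hi : ∀ a b, IntervalIntegrable (fun t => t * M t * Real.exp (-lam * t)) volume a b := by
    intro a b
    refine (hmono.intervalIntegrable_mul_continuous
      (g := fun t => t * Real.exp (-lam * t)) (by fun_prop) a b).congr fun t _ => ?_
    ring
  have h := hM.integral_eq_sub hlam hmono h0 (f := fun t => t * truncLaplace lam M t)
    (f' := fun t => truncLaplace lam M t + t * M t * Real.exp (-lam * t)) (by fun_prop)
    (fun t ht => ((hasDerivAt_id t).mul (hmono.hasDerivAt_integral_mul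
      (g := fun t => Real.exp (-lam * t)) (by fun_prop) ht)).congr_deriv (by
        simp only [id, truncLaplace]; ring))
    (fun a b => (hA.intervalIntegrable a b).add (hi a b)) x
  rw [intervalIntegral.integral_add (hA.intervalIntegrable _ _) (hi _ _)] at h
  linarith

lemma SatisfiesExpParkingEq.integral_expAverage {lam : ℝ} (hlam : 0 < lam) {M : ℝ → ℝ}
    (hmono : Monotone M) (hM : SatisfiesExpParkingEq lam M) (h0 : ∀ x ≤ 1, M x = 0) (x : ℝ) :
    lam * ∫ t in (0:ℝ)..x, expAverage lam M t =
      (lam * ∫ t in (0:ℝ)..x, M t) - expAverage lam M x := by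
  have hN := continuous_expAverage hmono lam
  have h := hM.integral_eq_sub hlam hmono h0 hN (fun t ht => hasDerivAt_expAverage hmono lam ht)
    (fun a b => (hmono.intervalIntegrable.sub (hN.intervalIntegrable a b)).const_mul lam) x
  rw [intervalIntegral.integral_const_mul,
    intervalIntegral.integral_sub hmono.intervalIntegrable (hN.intervalIntegrable _ _)] at h
  have h00 : expAverage lam M 0 = 0 := by simp [expAverage]
  linarith

/-- The balance identity: the conserved quantity of the delay equation in closed form. -/
lemma SatisfiesExpParkingEq.expAverage_add_window {lam : ℝ} (hlam : 0 < lam) {M : ℝ → ℝ}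
    (hmono : Monotone M) (hM : SatisfiesExpParkingEq lam M) (h0 : ∀ x ≤ 1, M x = 0)
    {x : ℝ} (hx : 0 ≤ x) :
    expAverage lam M (x + 1) + lam * ∫ t in x..(x + 1), expAverage lam M t =
      lam * (Real.exp lam * truncLaplace lam M (x + 1) - (1 - Real.exp (-lam * x)) / lam
        + lam * (x * truncLaplace lam M x - ∫ t in (0:ℝ)..x, t * M t * Real.exp (-lam * t))
        + x) := by
  have hA := continuous_truncLaplace hmono lam
  have hN := continuous_expAverage hmono lam
  have hM01 : ∀ g : ℝ → ℝ, ∫ t in (0:ℝ)..1, M t * g t = 0 := fun g => by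
    rw [intervalIntegral.integral_congr (g := fun _ => 0)]
    · simp
    · intro t ht
      rw [Set.uIcc_of_le zero_le_one] at ht
      simp [h0 t ht.2]
  have hshift : ∀ g : ℝ → ℝ, Continuous g → ∫ t in (0:ℝ)..x, M (t + 1) * g (t + 1) =
      ∫ t in (0:ℝ)..(x + 1), M t * g t := fun g hg => by
    rw [intervalIntegral.integral_comp_add_right (fun t => M t * g t) 1, zero_add,
      ← intervalIntegral.integral_add_adjacent_intervals
        (hmono.intervalIntegrable_mul_continuous hg 0 1)
        (hmono.intervalIntegrable_mul_continuous hg 1 (x + 1)), hM01, zero_add]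
  have hmono1 : Monotone fun t => M (t + 1) := fun s t hst => hmono (by linarith)
  have hE : ∫ t in (0:ℝ)..x, M (t + 1) * Real.exp (-lam * t) =
      Real.exp lam * truncLaplace lam M (x + 1) := by
    rw [truncLaplace, ← hshift (fun t => Real.exp (-lam * t)) (by fun_prop),
      ← intervalIntegral.integral_const_mul]
    refine intervalIntegral.integral_congr fun t _ => ?_
    have : Real.exp (-lam * t) = Real.exp lam * Real.exp (-lam * (t + 1)) := by
      rw [← Real.exp_add]; ring_nf
    simp only [this]
    ring
  have hexp : ∫ t in (0:ℝ)..x, Real.exp (-lam * t) = (1 - Real.exp (-lam * x)) / lam := by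
    rw [intervalIntegral.integral_comp_mul_left (fun t => Real.exp t) (by linarith : -lam ≠ 0)]
    simp
    field_simp
    ring
  have hM1 := hshift (fun _ => 1) continuous_const
  simp only [mul_one] at hM1
  have hmain : ∫ t in (0:ℝ)..x, (M (t + 1) - expAverage lam M t) =
      ∫ t in (0:ℝ)..x, (M (t + 1) * Real.exp (-lam * t) - Real.exp (-lam * t)
        + lam * truncLaplace lam M t + 1) := by
    refine intervalIntegral.integral_congr_ae (Eventually.of_forall fun t ht => ?_)
    rw [Set.uIoc_of_le hx] at ht
    linarith [hM.mul_one_sub_exp hlam hmono ht.1]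
  have hi1 : IntervalIntegrable (fun t => M (t + 1) * Real.exp (-lam * t)) volume 0 x :=
    hmono1.intervalIntegrable_mul_continuous (by fun_prop) _ _
  have hi2 : IntervalIntegrable (fun t => Real.exp (-lam * t)) volume 0 x :=
    Continuous.intervalIntegrable (by fun_prop) _ _
  have hi3 : IntervalIntegrable (fun t => lam * truncLaplace lam M t) volume 0 x :=
    Continuous.intervalIntegrable (by fun_prop) _ _
  rw [intervalIntegral.integral_sub hmono1.intervalIntegrable (hN.intervalIntegrable _ _),
    intervalIntegral.integral_add ((hi1.sub hi2).add hi3) (by simp),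
    intervalIntegral.integral_add (hi1.sub hi2) hi3, intervalIntegral.integral_sub hi1 hi2,
    intervalIntegral.integral_const_mul, hM.integral_truncLaplace hlam hmono h0, hE, hexp, hM1,
    intervalIntegral.integral_const, sub_zero, smul_eq_mul, mul_one] at hmain
  have hbal := hM.integral_expAverage hlam hmono h0 (x + 1)
  have hadj := intervalIntegral.integral_add_adjacent_intervals
    (hN.intervalIntegrable (μ := volume) 0 x) (hN.intervalIntegrable (μ := volume) x (x + 1))
  rw [← hmain]
  linear_combination hbal + lam * hadj

lemma integrableOn_mul_exp_of_le_pow {lam : ℝ} (hlam : 0 < lam) {f : ℝ → ℝ} (hf : Measurable f)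
    (k : ℕ) (hle : ∀ x > 0, |f x| ≤ x ^ k) :
    IntegrableOn (fun x => f x * Real.exp (-lam * x)) (Set.Ioi 0) := by
  have h := integrableOn_rpow_mul_exp_neg_mul_rpow (s := k) (p := 1)
    (by linarith [(Nat.cast_nonneg k : (0:ℝ) ≤ k)]) one_pos hlam
  simp only [Real.rpow_one, Real.rpow_natCast] at h
  refine Integrable.mono' h (by fun_prop) ?_
  filter_upwards [ae_restrict_mem measurableSet_Ioi] with x hx
  rw [norm_mul, Real.norm_eq_abs, Real.norm_eq_abs, abs_of_pos (Real.exp_pos _)]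
  exact mul_le_mul_of_nonneg_right (hle x hx) (Real.exp_pos _).le

lemma integrableOn_laplace {lam : ℝ} (hlam : 0 < lam) {M : ℝ → ℝ} (hmono : Monotone M)
    (hb : ∀ x, 0 ≤ x → 0 ≤ M x ∧ M x ≤ x) :
    IntegrableOn (fun x => M x * Real.exp (-lam * x)) (Set.Ioi 0) := by
  refine integrableOn_mul_exp_of_le_pow hlam hmono.measurable 1 fun x hx => ?_
  rw [pow_one, abs_of_nonneg (hb x hx.le).1]
  exact (hb x hx.le).2

lemma integrableOn_mul_laplace {lam : ℝ} (hlam : 0 < lam) {M : ℝ → ℝ} (hmono : Monotone M)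
    (hb : ∀ x, 0 ≤ x → 0 ≤ M x ∧ M x ≤ x) :
    IntegrableOn (fun x => x * M x * Real.exp (-lam * x)) (Set.Ioi 0) := by
  refine integrableOn_mul_exp_of_le_pow hlam (measurable_id.mul hmono.measurable) 2
    fun x hx => ?_
  rw [abs_of_nonneg (mul_nonneg hx.le (hb x hx.le).1), sq]
  exact mul_le_mul_of_nonneg_left (hb x hx.le).2 hx.le

/-- The tail of the Laplace integral is `o(1/x)`. -/
lemma tendsto_mul_truncLaplace_sub {lam : ℝ} (hlam : 0 < lam) {M : ℝ → ℝ} (hmono : Monotone M)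
    (hb : ∀ x, 0 ≤ x → 0 ≤ M x ∧ M x ≤ x) :
    Tendsto (fun x => x * (truncLaplace lam M x - ∫ t in Set.Ioi (0:ℝ), M t * Real.exp (-lam * t)))
      atTop (nhds 0) := by
  have h1 := integrableOn_laplace hlam hmono hb
  have h2 := integrableOn_mul_laplace hlam hmono hb
  have hlim := (intervalIntegral_tendsto_integral_Ioi 0 h2 tendsto_id).sub_const
    (∫ t in Set.Ioi (0:ℝ), t * M t * Real.exp (-lam * t))
  rw [sub_self] at hlim
  refine tendsto_of_tendsto_of_tendsto_of_le_of_le' hlim tendsto_const_nhds ?_ ?_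
  · filter_upwards [eventually_ge_atTop 0] with x hx
    have hsub : Set.Ioi x ⊆ Set.Ioi 0 := Set.Ioi_subset_Ioi hx
    rw [truncLaplace, ← intervalIntegral.integral_interval_add_Ioi h1 (h1.mono_set hsub),
      ← intervalIntegral.integral_interval_add_Ioi h2 (h2.mono_set hsub)]
    simp only [id, sub_add_cancel_left, mul_neg, neg_le_neg_iff]
    rw [← integral_const_mul]
    refine setIntegral_mono_on ((h1.mono_set hsub).const_mul x) (h2.mono_set hsub)
      measurableSet_Ioi fun t ht => ?_
    have hM := (hb t (hx.trans (le_of_lt ht))).1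
    have := mul_nonneg (sub_nonneg.2 (le_of_lt ht)) (mul_nonneg hM (Real.exp_pos (-lam * t)).le)
    linarith
  · filter_upwards [eventually_ge_atTop 0] with x hx
    have hsub : Set.Ioi x ⊆ Set.Ioi 0 := Set.Ioi_subset_Ioi hx
    rw [truncLaplace, ← intervalIntegral.integral_interval_add_Ioi h1 (h1.mono_set hsub)]
    rw [sub_add_cancel_left, mul_neg, neg_nonpos]
    refine mul_nonneg hx (setIntegral_nonneg measurableSet_Ioi fun t ht => ?_)
    exact mul_nonneg (hb t (hx.trans (le_of_lt ht))).1 (Real.exp_pos _).le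

lemma tendsto_truncLaplace {lam : ℝ} (hlam : 0 < lam) {M : ℝ → ℝ} (hmono : Monotone M)
    (hb : ∀ x, 0 ≤ x → 0 ≤ M x ∧ M x ≤ x) :
    Tendsto (truncLaplace lam M) atTop
      (nhds (∫ t in Set.Ioi (0:ℝ), M t * Real.exp (-lam * t))) :=
  intervalIntegral_tendsto_integral_Ioi 0 (integrableOn_laplace hlam hmono hb) tendsto_id

/-- The parking equation is a delay equation up to a vanishing error. -/
lemma SatisfiesExpParkingEq.tendsto_sub_expAverage {lam : ℝ} (hlam : 0 < lam) {M : ℝ → ℝ}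
    (hmono : Monotone M) (hM : SatisfiesExpParkingEq lam M)
    (hb : ∀ x, 0 ≤ x → 0 ≤ M x ∧ M x ≤ x) :
    Tendsto (fun x => M x - expAverage lam M (x - 1)) atTop
      (nhds (1 + lam * ∫ t in Set.Ioi (0:ℝ), M t * Real.exp (-lam * t))) := by
  have hexp : Tendsto (fun x => Real.exp (-lam * x)) atTop (nhds 0) :=
    Real.tendsto_exp_atBot.comp (tendsto_id.const_mul_atTop_of_neg (by linarith))
  have hxexp : Tendsto (fun x => x * Real.exp (-lam * x)) atTop (nhds 0) := by
    simpa using tendsto_rpow_mul_exp_neg_mul_atTop_nhds_zero 1 lam hlam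
  have hMexp : Tendsto (fun x => M (x + 1) * Real.exp (-lam * x)) atTop (nhds 0) := by
    have hlim := hxexp.add hexp
    rw [add_zero] at hlim
    refine tendsto_of_tendsto_of_tendsto_of_le_of_le' tendsto_const_nhds hlim ?_ ?_
    · filter_upwards [eventually_ge_atTop 0] with x hx
      exact mul_nonneg (hb _ (by linarith)).1 (Real.exp_pos _).le
    · filter_upwards [eventually_ge_atTop 0] with x hx
      have := mul_le_mul_of_nonneg_right (hb (x + 1) (by linarith)).2 (Real.exp_pos (-lam * x)).le
      linarith
  have h := (hMexp.sub hexp).add (((tendsto_truncLaplace hlam hmono hb).const_mul lam).const_add 1)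
  rw [sub_zero, zero_add] at h
  refine (h.comp (tendsto_atTop_add_const_right atTop (-1) tendsto_id)).congr' ?_
  filter_upwards [eventually_gt_atTop 1] with x hx
  have := hM.mul_one_sub_exp hlam hmono (x := x - 1) (by linarith)
  rw [sub_add_cancel] at this
  simp only [Function.comp, id, ← sub_eq_add_neg, sub_add_cancel]
  linarith

lemma SatisfiesExpParkingEq.tendsto_expAverage_sub {lam : ℝ} (hlam : 0 < lam) {M : ℝ → ℝ}
    (hmono : Monotone M) (hM : SatisfiesExpParkingEq lam M) (h0 : ∀ x ≤ 1, M x = 0)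
    (hb : ∀ x, 0 ≤ x → 0 ≤ M x ∧ M x ≤ x) {C : ℝ}
    (hC : C * (1 + lam) = lam * (1 + lam * ∫ t in Set.Ioi (0:ℝ), M t * Real.exp (-lam * t))) :
    Tendsto (fun x => expAverage lam M x - C * x) atTop
      (nhds ((lam * (Real.exp lam * (∫ t in Set.Ioi (0:ℝ), M t * Real.exp (-lam * t)) - 1 / lam
        - lam * ∫ t in Set.Ioi (0:ℝ), t * M t * Real.exp (-lam * t))
        - C * (1 + lam) + lam * C / 2) / (1 + lam))) := by
  set φ := ∫ t in Set.Ioi (0:ℝ), M t * Real.exp (-lam * t) with hφ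
  have hN := continuous_expAverage hmono lam
  have hn : Continuous fun x => expAverage lam M x - C * x := by fun_prop
  have herr := (hM.tendsto_sub_expAverage hlam hmono hb).sub_const (1 + lam * φ)
  rw [← hφ, sub_self] at herr
  refine tendsto_of_window_average hlam hn
    (fun η hη => eventually_delay_osc_le hlam (x₀ := 1) hn (fun t ht => ?_) herr hη) ?_
  · refine ((hasDerivAt_expAverage hmono lam (hM.continuousAt hlam hmono ht)).sub
      ((hasDerivAt_id t).const_mul C)).congr_deriv ?_
    linear_combination -hC
  · have hexp : Tendsto (fun x => Real.exp (-lam * x)) atTop (nhds 0) :=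
      Real.tendsto_exp_atBot.comp (tendsto_id.const_mul_atTop_of_neg (by linarith))
    have hA := tendsto_truncLaplace hlam hmono hb
    have hA1 := hA.comp (tendsto_atTop_add_const_right atTop (1:ℝ) tendsto_id)
    have hD := intervalIntegral_tendsto_integral_Ioi 0 (integrableOn_mul_laplace hlam hmono hb)
      tendsto_id
    have hT := tendsto_mul_truncLaplace_sub hlam hmono hb
    rw [← hφ] at hA hA1 hT
    have hlim := ((((hA1.const_mul (Real.exp lam)).sub
      ((hexp.const_sub 1).div_const lam)).add ((hT.sub hD).const_mul lam)).const_mul lam).add_const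
        (-(C * (1 + lam)) + lam * C / 2)
    have hlim' := hlim.comp (tendsto_atTop_add_const_right atTop (-1:ℝ) tendsto_id)
    convert hlim'.congr' ?_ using 2
    · ring
    filter_upwards [eventually_ge_atTop 1] with x hx
    have hbal := hM.expAverage_add_window hlam hmono h0 (x := x - 1) (by linarith)
    rw [sub_add_cancel] at hbal
    have hlin : ∫ t in (x - 1)..x, C * t = C * (x - 1 / 2) := by
      rw [intervalIntegral.integral_const_mul, integral_id]
      ring
    rw [intervalIntegral.integral_sub (hN.intervalIntegrable _ _)
      (Continuous.intervalIntegrable (by fun_prop) _ _), hlin]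
    simp only [Function.comp, id, ← sub_eq_add_neg, sub_add_cancel]
    linear_combination (x - 1) * hC - hbal

/-- The second-order asymptotics for a monotone solution vanishing on `(-∞, 1]`. -/
lemma SatisfiesExpParkingEq.tendsto_sub_slope {lam : ℝ} (hlam : 0 < lam) {M : ℝ → ℝ}
    (hmono : Monotone M) (hM : SatisfiesExpParkingEq lam M) (h0 : ∀ x ≤ 1, M x = 0)
    (hb : ∀ x, 0 ≤ x → 0 ≤ M x ∧ M x ≤ x)
    {C : ℝ} (hC : Tendsto (fun x => M x / x) atTop (nhds C)) :
    Tendsto (fun x : ℝ => M x - C * x) atTop (nhds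
      (-(lam * (lam + 2) *
          (1 + lam * ∫ x in Set.Ioi (0:ℝ), M x * Real.exp (-lam * x)))
        / (2 * (lam + 1) ^ 2)
      + (lam / (lam + 1)) *
        ((1 + Real.exp lam) * (∫ x in Set.Ioi (0:ℝ), M x * Real.exp (-lam * x))
          + lam * (-∫ x in Set.Ioi (0:ℝ), x * M x * Real.exp (-lam * x))))) := by
  have hlam1 : 1 + lam ≠ 0 := by linarith
  have hlam1' : lam + 1 ≠ 0 := by linarith
  have hconv := hM.tendsto_sub_expAverage hlam hmono hb
  have hN := fun K => hM.tendsto_expAverage_sub hlam hmono h0 hb (C := K)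
  set φ := ∫ t in Set.Ioi (0:ℝ), M t * Real.exp (-lam * t)
  set ψ := ∫ t in Set.Ioi (0:ℝ), t * M t * Real.exp (-lam * t)
  obtain ⟨K, hK⟩ : ∃ K, K * (1 + lam) = lam * (1 + lam * φ) :=
    ⟨_, div_mul_cancel₀ _ hlam1⟩
  have hlim := (hconv.add ((hN K hK).comp
    (tendsto_atTop_add_const_right atTop (-1:ℝ) tendsto_id))).sub_const K
  have hlim' := hlim.congr (f₂ := fun x => M x - K * x) fun x => by
    simp only [Function.comp, id, ← sub_eq_add_neg]
    ring
  have hCK : C = K := by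
    refine tendsto_nhds_unique hC ?_
    have h := (hlim'.div_atTop tendsto_id).add_const K
    rw [zero_add] at h
    refine h.congr' ?_
    filter_upwards [eventually_gt_atTop 0] with x hx
    simp only [id]
    field_simp
    ring
  rw [hCK]
  have hKdiv : K = lam * (1 + lam * φ) / (1 + lam) := by rw [eq_div_iff hlam1, hK]
  convert hlim' using 2
  rw [hKdiv]
  field_simp
  ring

/-- **Formula (14) of the paper.** For a solution of the exponential parking
equation with asymptotic slope `C_λ`, the limit `B_λ = lim_{x→∞} (M x - C_λ x)`
exists and equals
`-λ(λ+2)(1 + λφ(λ))/(2(λ+1)²) + (λ/(λ+1))((1 + e^λ)φ(λ) + λφ′(λ))`,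
where `φ(λ) = ∫₀^∞ M x e^{-λx} dx` and `φ′(λ) = -∫₀^∞ x M x e^{-λx} dx`. -/
theorem expParking_second_constant
    (lam : ℝ) (hlam : 0 < lam) (M : ℝ → ℝ)
    (hmeas : Measurable M)
    (hmono : MonotoneOn M (Set.Ici 0))
    (hbound : ∀ x : ℝ, 0 ≤ x → 0 ≤ M x ∧ M x ≤ x)
    (hM : SatisfiesExpParkingEq lam M)
    (Cl : ℝ) (hCl : Tendsto (fun x : ℝ => M x / x) atTop (nhds Cl)) :
    Tendsto (fun x : ℝ => M x - Cl * x) atTop (nhds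
      (-(lam * (lam + 2) *
          (1 + lam * ∫ x in Set.Ioi (0:ℝ), M x * Real.exp (-lam * x)))
        / (2 * (lam + 1) ^ 2)
      + (lam / (lam + 1)) *
        ((1 + Real.exp lam) * (∫ x in Set.Ioi (0:ℝ), M x * Real.exp (-lam * x))
          + lam * (-∫ x in Set.Ioi (0:ℝ), x * M x * Real.exp (-lam * x))))) := by
  have hmax : ∀ x : ℝ, 0 ≤ x → M (max x 0) = M x := fun x hx => by rw [max_eq_left hx]
  have hvanish : ∀ x ≤ 1, M (max x 0) = 0 := fun x hx =>
    hM.1 _ (le_max_right _ _) (max_le hx zero_le_one)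
  have hmono' : Monotone fun x => M (max x 0) := fun x y hxy =>
    hmono (le_max_right x 0) (le_max_right y 0) (max_le_max_right 0 hxy)
  have heq : SatisfiesExpParkingEq lam fun x => M (max x 0) := by
    refine ⟨fun x _ hx => hvanish x hx, fun x hx => ?_⟩
    beta_reduce
    rw [hmax _ (by linarith), hM.2 x hx]
    congr 1
    refine intervalIntegral.integral_congr fun t ht => ?_
    rw [Set.uIcc_of_le hx.le] at ht
    simp only [hmax t ht.1, hmax (x - t) (sub_nonneg.2 ht.2)]
  have hφ : ∫ x in Set.Ioi (0:ℝ), M (max x 0) * Real.exp (-lam * x) =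
      ∫ x in Set.Ioi (0:ℝ), M x * Real.exp (-lam * x) :=
    setIntegral_congr_fun measurableSet_Ioi fun x hx => by simp only [hmax x (le_of_lt hx)]
  have hψ : ∫ x in Set.Ioi (0:ℝ), x * M (max x 0) * Real.exp (-lam * x) =
      ∫ x in Set.Ioi (0:ℝ), x * M x * Real.exp (-lam * x) :=
    setIntegral_congr_fun measurableSet_Ioi fun x hx => by simp only [hmax x (le_of_lt hx)]
  have h := heq.tendsto_sub_slope hlam hmono' hvanish
    (fun x hx => by simpa only [hmax x hx] using hbound x hx) (hCl.congr' (by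
      filter_upwards [eventually_ge_atTop 0] with x hx
      rw [hmax x hx]))
  rw [hφ, hψ] at h
  refine h.congr' ?_
  filter_upwards [eventually_ge_atTop 0] with x hx
  rw [hmax x hx]
end

section
/- Let λ > 0, let M : ℝ → ℝ be measurable and nondecreasing with 0 ≤ M(x) ≤ x for all x ≥ 0, satisfying the exponential parking equation with rate λ, and let C_λ = lim_{x→∞} M(x)/x. Let M₂ : ℝ → ℝ be measurable and nondecreasing with M₂(x) = 0 for 0 ≤ x ≤ 1 and 0 ≤ M₂(x) ≤ x² for all x ≥ 0, satisfying, for every x > 0, M₂(x+1) = ∫₀ˣ (λ e^{−λt}/(1 − e^{−λx})) (M₂(t) + M₂(x−t) + 2M(t) + 2M(x−t) + 2M(t)M(x−t)) dt + 1. Then lim_{x→∞} M₂(x)/x² = C_λ². -/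
open MeasureTheory Filter

/-- The density of the exponential law of rate `lam` conditioned on `[0, x]`. -/
noncomputable def truncExpDensity (lam x t : ℝ) : ℝ :=
  lam * Real.exp (-lam * t) / (1 - Real.exp (-lam * x))

section Density

variable {lam x : ℝ}

theorem one_sub_exp_neg_mul_pos (hlam : 0 < lam) (hx : 0 < x) :
    0 < 1 - Real.exp (-lam * x) := by
  have : Real.exp (-lam * x) < 1 := Real.exp_lt_one_iff.mpr (by nlinarith)
  linarith

theorem truncExpDensity_nonneg (hlam : 0 < lam) (hx : 0 < x) (t : ℝ) :
    0 ≤ truncExpDensity lam x t :=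
  div_nonneg (by positivity) (one_sub_exp_neg_mul_pos hlam hx).le

theorem continuous_truncExpDensity (lam x : ℝ) : Continuous (truncExpDensity lam x) := by
  unfold truncExpDensity
  fun_prop

theorem integral_truncExpDensity (lam x a b : ℝ) :
    ∫ t in a..b, truncExpDensity lam x t =
      (Real.exp (-lam * a) - Real.exp (-lam * b)) / (1 - Real.exp (-lam * x)) := by
  have key : ∀ t ∈ Set.uIcc a b, HasDerivAt
      (fun t => -Real.exp (-lam * t) / (1 - Real.exp (-lam * x)))
      (truncExpDensity lam x t) t := fun t _ => by
    have h := (((hasDerivAt_id t).const_mul (-lam)).exp.neg).div_const (1 - Real.exp (-lam * x))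
    refine h.congr_deriv ?_
    simp only [truncExpDensity, id]
    ring
  rw [intervalIntegral.integral_eq_sub_of_hasDerivAt key
    ((continuous_truncExpDensity lam x).intervalIntegrable _ _)]
  ring

theorem integral_truncExpDensity_eq_one (hlam : 0 < lam) (hx : 0 < x) :
    ∫ t in (0:ℝ)..x, truncExpDensity lam x t = 1 := by
  rw [integral_truncExpDensity, mul_zero, Real.exp_zero,
    div_self (one_sub_exp_neg_mul_pos hlam hx).ne']

theorem integral_truncExpDensity_mul_sq_le (hlam : 0 < lam) (hx : 0 < x) :
    ∫ t in (0:ℝ)..x, truncExpDensity lam x t * t ^ 2 ≤ 2 / lam ^ 2 := by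
  have hZ := one_sub_exp_neg_mul_pos hlam hx
  have key : ∀ t ∈ Set.uIcc 0 x, HasDerivAt
      (fun t => -((t ^ 2 + 2 / lam * t + 2 / lam ^ 2) * Real.exp (-lam * t)) /
        (1 - Real.exp (-lam * x)))
      (truncExpDensity lam x t * t ^ 2) t := fun t _ => by
    have h1 := (((hasDerivAt_id t).const_mul (-lam)).exp)
    have h2 := ((((hasDerivAt_id t).pow 2).add ((hasDerivAt_id t).const_mul (2 / lam))).add_const
      (2 / lam ^ 2))
    have h := ((h2.mul h1).neg).div_const (1 - Real.exp (-lam * x))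
    refine h.congr_deriv ?_
    simp only [truncExpDensity, id, Pi.add_apply, Pi.pow_apply]
    field_simp
    norm_num
    ring
  rw [intervalIntegral.integral_eq_sub_of_hasDerivAt key
    (((continuous_truncExpDensity lam x).mul (continuous_pow 2)).intervalIntegrable _ _),
    ← sub_div, div_le_iff₀ hZ]
  have : 0 ≤ (x ^ 2 + 2 / lam * x) * Real.exp (-lam * x) := by positivity
  simp only [mul_zero, Real.exp_zero]
  nlinarith

theorem intervalIntegrable_truncExpDensity_mul {h : ℝ → ℝ} (hx : 0 ≤ x) (hh : Measurable h)
    {B : ℝ} (hB : ∀ t, 0 ≤ t → t ≤ x → |h t| ≤ B) :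
    IntervalIntegrable (fun t => truncExpDensity lam x t * h t) volume 0 x := by
  refine IntervalIntegrable.continuousOn_mul ?_ (continuous_truncExpDensity lam x).continuousOn
  rw [intervalIntegrable_iff_integrableOn_Icc_of_le hx]
  refine Measure.integrableOn_of_bounded (M := B) (by simp) hh.aestronglyMeasurable ?_
  filter_upwards [ae_restrict_mem measurableSet_Icc] with t ht
  exact hB t ht.1 ht.2

end Density

section FirstMoment

variable {lam : ℝ} {M : ℝ → ℝ}

theorem intervalIntegrable_truncExpDensity_mul_add_reflect {x : ℝ} (hx : 0 ≤ x)
    (hmeas : Measurable M) (hbound : ∀ x : ℝ, 0 ≤ x → 0 ≤ M x ∧ M x ≤ x) :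
    IntervalIntegrable (fun t => truncExpDensity lam x t * (M t + M (x - t))) volume 0 x := by
  refine intervalIntegrable_truncExpDensity_mul (B := x) hx (by fun_prop) fun t h0 h1 => ?_
  have a := hbound t h0
  have b := hbound (x - t) (by linarith)
  rw [abs_le]
  constructor <;> linarith

/-- A solution of the exponential parking equation has bounded increments over unit steps. -/
theorem SatisfiesExpParkingEq.sub_sub_one_le (hlam : 0 < lam) (hmeas : Measurable M)
    (hmono : MonotoneOn M (Set.Ici 0)) (hbound : ∀ x : ℝ, 0 ≤ x → 0 ≤ M x ∧ M x ≤ x)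
    (hM : SatisfiesExpParkingEq lam M) {x : ℝ} (hx : 2 ≤ x) :
    M x - M (x - 1) ≤ (2 / lam ^ 2 + 2) / (Real.exp (-lam) - Real.exp (-lam * 2)) := by
  have hx0 : 0 < x := by linarith
  have hZ := one_sub_exp_neg_mul_pos hlam hx0
  have hp := truncExpDensity_nonneg hlam hx0
  have hpc := continuous_truncExpDensity lam x
  have heq : M (x + 1) =
      (∫ t in (0:ℝ)..x, truncExpDensity lam x t * (M t + M (x - t))) + 1 := hM.2 x hx0
  have hle : M x ≤ M (x + 1) := hmono hx0.le (by simp; linarith) (by linarith)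
  have hq : 0 < Real.exp (-lam) - Real.exp (-lam * 2) :=
    sub_pos.mpr (Real.exp_lt_exp.mpr (by linarith))
  have hint : IntervalIntegrable
      (fun t => truncExpDensity lam x t * (M x - M (x - t))) volume 0 x := by
    refine intervalIntegrable_truncExpDensity_mul (B := x) hx0.le (by fun_prop) fun t h0 h1 => ?_
    have a := hbound x hx0.le
    have b := hbound (x - t) (by linarith)
    rw [abs_le]
    constructor <;> linarith
  have hint1 : IntervalIntegrable (fun t => truncExpDensity lam x t) volume 0 x :=
    hpc.intervalIntegrable _ _
  have hint2 : IntervalIntegrable (fun t => truncExpDensity lam x t * t ^ 2) volume 0 x :=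
    (hpc.mul (continuous_pow 2)).intervalIntegrable _ _
  have hintM := intervalIntegrable_truncExpDensity_mul_add_reflect (lam := lam) hx0.le hmeas hbound
  have hupper : ∫ t in (0:ℝ)..x, truncExpDensity lam x t * (M x - M (x - t)) ≤
      2 / lam ^ 2 + 2 := by
    have h1 : ∫ t in (0:ℝ)..x, truncExpDensity lam x t * (M x - M (x - t)) ≤
        ∫ t in (0:ℝ)..x, ((M x + 1) * truncExpDensity lam x t + truncExpDensity lam x t * t ^ 2
          - truncExpDensity lam x t * (M t + M (x - t))) := by
      refine intervalIntegral.integral_mono_on hx0.le hint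
        (((hint1.const_mul _).add hint2).sub hintM) fun t ht => ?_
      have a := (hbound t ht.1).2
      have b : 0 ≤ 1 + t ^ 2 - M t := by nlinarith [sq_nonneg (t - 1), sq_nonneg t]
      nlinarith [mul_nonneg (hp t) b]
    rw [intervalIntegral.integral_sub ((hint1.const_mul _).add hint2) hintM,
      intervalIntegral.integral_add (hint1.const_mul _) hint2,
      intervalIntegral.integral_const_mul, integral_truncExpDensity_eq_one hlam hx0] at h1
    linarith [integral_truncExpDensity_mul_sq_le hlam hx0]
  have hsub1 : Set.uIcc 0 1 ⊆ Set.uIcc 0 x := by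
    rw [Set.uIcc_of_le zero_le_one, Set.uIcc_of_le hx0.le]
    exact Set.Icc_subset_Icc le_rfl (by linarith)
  have hsub2 : Set.uIcc 1 x ⊆ Set.uIcc 0 x := by
    rw [Set.uIcc_of_le (by linarith), Set.uIcc_of_le hx0.le]
    exact Set.Icc_subset_Icc zero_le_one le_rfl
  have hmonoM : ∀ s t : ℝ, 0 ≤ s → s ≤ t → M s ≤ M t := fun s t h0 h =>
    hmono h0 (h0.trans h) h
  have hlower : (Real.exp (-lam) - Real.exp (-lam * 2)) * (M x - M (x - 1)) ≤
      ∫ t in (0:ℝ)..x, truncExpDensity lam x t * (M x - M (x - t)) := by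
    rw [← intervalIntegral.integral_add_adjacent_intervals (hint.mono_set hsub1)
      (hint.mono_set hsub2)]
    have h1 : 0 ≤ ∫ t in (0:ℝ)..1, truncExpDensity lam x t * (M x - M (x - t)) := by
      refine intervalIntegral.integral_nonneg zero_le_one fun t ht => mul_nonneg (hp t) ?_
      linarith [hmonoM (x - t) x (by linarith [ht.2]) (by linarith [ht.1])]
    have h2 : ∫ t in (1:ℝ)..x, truncExpDensity lam x t * (M x - M (x - 1)) ≤
        ∫ t in (1:ℝ)..x, truncExpDensity lam x t * (M x - M (x - t)) := by
      refine intervalIntegral.integral_mono_on (by linarith)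
        ((hpc.mul continuous_const).intervalIntegrable _ _) (hint.mono_set hsub2) fun t ht => ?_
      refine mul_le_mul_of_nonneg_left ?_ (hp t)
      linarith [hmonoM (x - t) (x - 1) (by linarith [ht.2]) (by linarith [ht.1])]
    rw [intervalIntegral.integral_mul_const, integral_truncExpDensity, mul_one] at h2
    have h3 : Real.exp (-lam) - Real.exp (-lam * 2) ≤
        (Real.exp (-lam) - Real.exp (-lam * x)) / (1 - Real.exp (-lam * x)) := by
      rw [le_div_iff₀ hZ]
      have : Real.exp (-lam * x) ≤ Real.exp (-lam * 2) := Real.exp_le_exp.mpr (by nlinarith)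
      nlinarith [Real.exp_pos (-lam * x)]
    have h4 := mul_le_mul_of_nonneg_right h3
      (show 0 ≤ M x - M (x - 1) by
        linarith [hmonoM (x - 1) x (by linarith) (by linarith)])
    linarith
  rw [le_div_iff₀ hq]
  linarith

/-- A solution of the exponential parking equation is Lipschitz at large scales. -/
theorem SatisfiesExpParkingEq.exists_sub_le (hlam : 0 < lam) (hmeas : Measurable M)
    (hmono : MonotoneOn M (Set.Ici 0)) (hbound : ∀ x : ℝ, 0 ≤ x → 0 ≤ M x ∧ M x ≤ x)
    (hM : SatisfiesExpParkingEq lam M) :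
    ∃ L : ℝ, 0 ≤ L ∧ (∀ a b : ℝ, 0 ≤ a → a ≤ b → M b - M a ≤ L * (b - a + 1)) := by
  obtain ⟨L, hL2, hL⟩ : ∃ L : ℝ, 2 ≤ L ∧ ∀ x : ℝ, 2 ≤ x → M x - M (x - 1) ≤ L :=
    ⟨max 2 _, le_max_left _ _, fun x hx =>
      (hM.sub_sub_one_le hlam hmeas hmono hbound hx).trans (le_max_right _ _)⟩
  have hunit : ∀ a b : ℝ, 0 ≤ a → a ≤ b → b ≤ a + 1 → M b - M a ≤ L := fun a b ha hab hb => by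
    rcases le_total b 2 with h | h
    · linarith [(hbound a ha).1, (hbound b (ha.trans hab)).2]
    · have : M (b - 1) ≤ M a := hmono (by simp; linarith) ha (by linarith)
      linarith [hL b h]
  have hnat : ∀ n : ℕ, ∀ a b : ℝ, 0 ≤ a → a ≤ b → b ≤ a + n → M b - M a ≤ L * n := fun n => by
    induction n with
    | zero =>
      intro a b ha hab hb
      obtain rfl : a = b := by
        push_cast at hb
        linarith
      simp
    | succ n ih =>
      intro a b ha hab hb
      push_cast at hb ⊢
      rcases le_total b (a + 1) with h | h
      · nlinarith [hunit a b ha hab h, (Nat.cast_nonneg n : (0:ℝ) ≤ n)]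
      · linarith [hunit a (a + 1) ha (by linarith) le_rfl,
          ih (a + 1) b (by linarith) h (by linarith)]
  refine ⟨L, by linarith, fun a b ha hab => ?_⟩
  refine (hnat ⌈b - a⌉₊ a b ha hab (by linarith [Nat.le_ceil (b - a)])).trans ?_
  exact mul_le_mul_of_nonneg_left (Nat.ceil_lt_add_one (by linarith)).le (by linarith)

end FirstMoment

/-- The variance `M₂ - M²` satisfies the parking recursion with source term the variance of
`M T + M (x - T) + 1`. -/
theorem variance_parking_recursion {lam : ℝ} (hlam : 0 < lam) {M M2 : ℝ → ℝ}
    (hmeas : Measurable M) (hbound : ∀ x : ℝ, 0 ≤ x → 0 ≤ M x ∧ M x ≤ x)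
    (hM : SatisfiesExpParkingEq lam M) (hmeas2 : Measurable M2)
    (hbound2 : ∀ x : ℝ, 0 ≤ x → 0 ≤ M2 x ∧ M2 x ≤ x ^ 2)
    {x : ℝ} (hx : 0 < x)
    (hM2eq : M2 (x + 1) = (∫ t in (0:ℝ)..x, truncExpDensity lam x t *
      (M2 t + M2 (x - t) + 2 * M t + 2 * M (x - t) + 2 * M t * M (x - t))) + 1) :
    M2 (x + 1) - M (x + 1) ^ 2 = ∫ t in (0:ℝ)..x, truncExpDensity lam x t *
      ((M2 t - M t ^ 2) + (M2 (x - t) - M (x - t) ^ 2) +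
        (M t + M (x - t) + 1 - M (x + 1)) ^ 2) := by
  have heq : M (x + 1) =
      (∫ t in (0:ℝ)..x, truncExpDensity lam x t * (M t + M (x - t))) + 1 := hM.2 x hx
  have hint1 : IntervalIntegrable (fun t => truncExpDensity lam x t) volume 0 x :=
    (continuous_truncExpDensity lam x).intervalIntegrable _ _
  have hintM := intervalIntegrable_truncExpDensity_mul_add_reflect (lam := lam) hx.le hmeas hbound
  have hint2 : IntervalIntegrable (fun t => truncExpDensity lam x t *
      (M2 t + M2 (x - t) + 2 * M t + 2 * M (x - t) + 2 * M t * M (x - t))) volume 0 x := by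
    refine intervalIntegrable_truncExpDensity_mul (B := x ^ 2 + 2 * x) hx.le (by fun_prop)
      fun t h0 h1 => ?_
    obtain ⟨a, a'⟩ := hbound t h0
    obtain ⟨b, b'⟩ := hbound (x - t) (by linarith)
    obtain ⟨c, c'⟩ := hbound2 t h0
    obtain ⟨d, d'⟩ := hbound2 (x - t) (by linarith)
    have e : M t * M (x - t) ≤ t * (x - t) := mul_le_mul a' b' b h0
    rw [abs_of_nonneg (by positivity)]
    nlinarith
  have hsplit : ∫ t in (0:ℝ)..x, truncExpDensity lam x t *
      ((M2 t - M t ^ 2) + (M2 (x - t) - M (x - t) ^ 2) +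
        (M t + M (x - t) + 1 - M (x + 1)) ^ 2) =
      ∫ t in (0:ℝ)..x, (truncExpDensity lam x t *
        (M2 t + M2 (x - t) + 2 * M t + 2 * M (x - t) + 2 * M t * M (x - t)) -
        2 * M (x + 1) * (truncExpDensity lam x t * (M t + M (x - t))) +
        (1 - M (x + 1)) ^ 2 * truncExpDensity lam x t) := by
    congr 1
    funext t
    ring
  rw [hsplit, intervalIntegral.integral_add (hint2.sub (hintM.const_mul _)) (hint1.const_mul _),
    intervalIntegral.integral_sub hint2 (hintM.const_mul _), intervalIntegral.integral_const_mul,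
    intervalIntegral.integral_const_mul, integral_truncExpDensity_eq_one hlam hx, hM2eq,
    eq_sub_of_add_eq heq.symm]
  ring

/-- The variance `M₂ - M²` grows at most linearly. -/
theorem exists_abs_variance_le_mul {lam : ℝ} (hlam : 0 < lam) {M M2 : ℝ → ℝ}
    (hmeas : Measurable M) (hmono : MonotoneOn M (Set.Ici 0))
    (hbound : ∀ x : ℝ, 0 ≤ x → 0 ≤ M x ∧ M x ≤ x)
    (hM : SatisfiesExpParkingEq lam M) (hmeas2 : Measurable M2)
    (hM2zero : ∀ x : ℝ, 0 ≤ x → x ≤ 1 → M2 x = 0)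
    (hbound2 : ∀ x : ℝ, 0 ≤ x → 0 ≤ M2 x ∧ M2 x ≤ x ^ 2)
    (hM2eq : ∀ x : ℝ, 0 < x → M2 (x + 1) = (∫ t in (0:ℝ)..x, truncExpDensity lam x t *
      (M2 t + M2 (x - t) + 2 * M t + 2 * M (x - t) + 2 * M t * M (x - t))) + 1) :
    ∃ A : ℝ, ∀ x : ℝ, 0 ≤ x → |M2 x - M x ^ 2| ≤ A * x := by
  obtain ⟨L, hL0, hL⟩ := hM.exists_sub_le hlam hmeas hmono hbound
  set V : ℝ := 1 + 2 * (1 + 2 * L) ^ 2 with hV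
  have hV0 : 0 ≤ V := by positivity
  set A : ℝ := V * (2 / lam ^ 2 + 1) with hA
  have hA0 : 0 ≤ A := by positivity
  have hnat : ∀ n : ℕ, ∀ x : ℝ, 0 ≤ x → x ≤ n + 1 → |M2 x - M x ^ 2| ≤ A * x := fun n => by
    induction n with
    | zero =>
      intro x h0 h1
      have h1 : x ≤ 1 := by simpa using h1
      rw [hM2zero x h0 h1, hM.1 x h0 h1]
      simpa using mul_nonneg hA0 h0
    | succ n ih =>
      intro y h0 h1
      push_cast at h1
      rcases le_or_gt y (n + 1) with h | h
      · exact ih y h0 h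
      obtain ⟨x, rfl⟩ : ∃ x, y = x + 1 := ⟨y - 1, by ring⟩
      have hx : 0 < x := by linarith [(Nat.cast_nonneg n : (0:ℝ) ≤ n)]
      have hp := truncExpDensity_nonneg hlam hx
      have hpc := continuous_truncExpDensity lam x
      have hint1 : IntervalIntegrable (fun t => truncExpDensity lam x t) volume 0 x :=
        hpc.intervalIntegrable _ _
      have hint2 : IntervalIntegrable (fun t => truncExpDensity lam x t * t ^ 2) volume 0 x :=
        (hpc.mul (continuous_pow 2)).intervalIntegrable _ _
      rw [variance_parking_recursion hlam hmeas hbound hM hmeas2 hbound2 hx (hM2eq x hx),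
        ← Real.norm_eq_abs]
      have hdom := intervalIntegral.norm_integral_le_of_norm_le hx.le
        (f := fun t => truncExpDensity lam x t *
          ((M2 t - M t ^ 2) + (M2 (x - t) - M (x - t) ^ 2) +
            (M t + M (x - t) + 1 - M (x + 1)) ^ 2))
        (g := fun t => (A * x + V) * truncExpDensity lam x t +
          V * (truncExpDensity lam x t * t ^ 2)) (μ := volume)
        (Eventually.of_forall fun t ht => ?_)
        ((hint1.const_mul _).add (hint2.const_mul _))
      · refine hdom.trans ?_
        rw [intervalIntegral.integral_add (hint1.const_mul _) (hint2.const_mul _),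
          intervalIntegral.integral_const_mul, intervalIntegral.integral_const_mul,
          integral_truncExpDensity_eq_one hlam hx]
        have := mul_le_mul_of_nonneg_left (integral_truncExpDensity_mul_sq_le hlam hx) hV0
        rw [hA] at *
        linarith
      · obtain ⟨ht0, htx⟩ := ht
        have hD1 : |M2 t - M t ^ 2| ≤ t ^ 2 := by
          have a := hbound t ht0.le
          have b := hbound2 t ht0.le
          rw [abs_le]
          constructor <;> nlinarith
        have hD2 := ih (x - t) (by linarith) (by linarith)
        have hdev : |M t + M (x - t) + 1 - M (x + 1)| ≤ (1 + 2 * L) * (t + 1) := by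
          have a := hbound t ht0.le
          have b := hL (x - t) (x + 1) (by linarith) (by linarith)
          have c : M (x - t) ≤ M (x + 1) :=
            hmono (by simp; linarith) (by simp; linarith) (by linarith)
          rw [abs_le]
          constructor <;> nlinarith [mul_nonneg hL0 ht0.le]
        have hsq : (M t + M (x - t) + 1 - M (x + 1)) ^ 2 ≤
            2 * (1 + 2 * L) ^ 2 * (t ^ 2 + 1) := by
          have := sq_le_sq' (abs_le.mp hdev).1 (abs_le.mp hdev).2
          nlinarith [mul_nonneg (sq_nonneg (1 + 2 * L)) (sq_nonneg (t - 1))]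
        have hsum : |(M2 t - M t ^ 2) + (M2 (x - t) - M (x - t) ^ 2) +
            (M t + M (x - t) + 1 - M (x + 1)) ^ 2| ≤ A * x + V + V * t ^ 2 := by
          refine (abs_add_three _ _ _).trans ?_
          rw [abs_of_nonneg (sq_nonneg (M t + M (x - t) + 1 - M (x + 1)))]
          nlinarith [mul_nonneg hA0 ht0.le]
        rw [norm_mul, Real.norm_eq_abs, Real.norm_eq_abs, abs_of_nonneg (hp t)]
        nlinarith [mul_le_mul_of_nonneg_left hsum (hp t)]
  exact ⟨A, fun x hx => hnat ⌈x⌉₊ x hx (by linarith [Nat.le_ceil x])⟩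

/-- **Section 6 of the paper.** The second moment `M₂`, which satisfies the
integral equation (28), has leading-order asymptotics
`lim_{x→∞} M₂ x / x² = C_λ²`. -/
theorem expParking_second_moment_asymptotics
    (lam : ℝ) (hlam : 0 < lam) (M M2 : ℝ → ℝ)
    (hmeas : Measurable M)
    (hmono : MonotoneOn M (Set.Ici 0))
    (hbound : ∀ x : ℝ, 0 ≤ x → 0 ≤ M x ∧ M x ≤ x)
    (hM : SatisfiesExpParkingEq lam M)
    (Cl : ℝ) (hCl : Tendsto (fun x : ℝ => M x / x) atTop (nhds Cl))
    (hmeas2 : Measurable M2)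
    (hmono2 : MonotoneOn M2 (Set.Ici 0))
    (hM2zero : ∀ x : ℝ, 0 ≤ x → x ≤ 1 → M2 x = 0)
    (hbound2 : ∀ x : ℝ, 0 ≤ x → 0 ≤ M2 x ∧ M2 x ≤ x ^ 2)
    (hM2eq : ∀ x : ℝ, 0 < x →
      M2 (x + 1) = (∫ t in (0:ℝ)..x,
        (lam * Real.exp (-lam * t) / (1 - Real.exp (-lam * x))) *
          (M2 t + M2 (x - t) + 2 * M t + 2 * M (x - t) + 2 * M t * M (x - t))) + 1) :
    Tendsto (fun x : ℝ => M2 x / x ^ 2) atTop (nhds (Cl ^ 2)) := by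
  obtain ⟨A, hA⟩ := exists_abs_variance_le_mul hlam hmeas hmono hbound hM hmeas2 hM2zero
    hbound2 hM2eq
  have hvar : Tendsto (fun x : ℝ => (M2 x - M x ^ 2) / x ^ 2) atTop (nhds 0) := by
    refine squeeze_zero_norm' ?_ ((tendsto_const_nhds (x := A)).div_atTop tendsto_id)
    filter_upwards [eventually_gt_atTop 0] with x hx
    rw [norm_div, Real.norm_eq_abs, Real.norm_of_nonneg (sq_nonneg x), id,
      div_le_div_iff₀ (by positivity) hx]
    nlinarith [mul_le_mul_of_nonneg_right (hA x hx.le) hx.le]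
  have hsum := hvar.add (hCl.pow 2)
  rw [zero_add] at hsum
  refine hsum.congr fun x => ?_
  rw [div_pow, ← add_div, sub_add_cancel]
end
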